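/- arXiv:math/0307076 — 2 statements merged into one kernel-verified Lean document; each statement's English description precedes it below -/
import Mathlib

section
/- Let ℓ ≠ p be primes, k an algebraic closure of a finite field of characteristic p, and K'|k a function field with td(K'|k) ≥ 1. Then every closed abelian normal subgroup of the Galois group G^ℓ_{K'} = Gal(K'^ℓ|K') is trivial. -/
open IntermediateField

/-- Transcendence degree of a ring extension. -/
noncomputable def trdeg (k K : Type*) [CommRing k] [CommRing K] [Algebra k K] : Cardinal :=
  ⨆ s : {s : Set K // AlgebraicIndependent k ((↑) : s → K)}, Cardinal.mk s.1

/-- The maximal pro-ℓ Galois extension of `K`, inside a fixed algebraic closure: the compositum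
of all finite Galois extensions of `K` of `ℓ`-power degree. -/
noncomputable def proL (ℓ : ℕ) (K : Type*) [Field K] :
    IntermediateField K (AlgebraicClosure K) :=
  ⨆ L ∈ {L : IntermediateField K (AlgebraicClosure K) |
      IsGalois K L ∧ ∃ n : ℕ, Module.finrank K L = ℓ ^ n}, L

/-- `G^ℓ_K`, the Galois group of the maximal pro-ℓ extension of `K`,
carrying the Krull topology. -/
noncomputable abbrev GalL (ℓ : ℕ) (K : Type*) [Field K] :=
  ↥(proL ℓ K) ≃ₐ[K] ↥(proL ℓ K)


namespace St4
open Polynomial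

/-- Kummer independence. -/
lemma kummer_indep (ℓ : ℕ) [Fact ℓ.Prime] {P F ι : Type*} [Field P] [Field F] [Algebra P F]
    [Module.Finite P F] [Infinite ι] (hℓ : (ℓ : P) ≠ 0)
    (ζ : P) (hζ : IsPrimitiveRoot ζ ℓ) (γ : ι → F) (h0 : ∀ i, γ i ≠ 0)
    (hγ : ∀ i, ∃ c : P, algebraMap P F c = γ i ^ ℓ) :
    ∃ i j, i ≠ j ∧ ∃ c : P, algebraMap P F c = γ i / γ j := by
  have hpos : 0 < ℓ := (Fact.out : ℓ.Prime).pos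
  have : NeZero ℓ := ⟨hpos.ne'⟩
  by_contra! H
  apply not_finite_iff_infinite.2 ‹Infinite ι›
  suffices LinearIndependent P γ from this.finite
  let Ω := AlgebraicClosure F
  let E := separableClosure P Ω
  have : IsGalois P E := inferInstance
  have hsep : ∀ i, algebraMap F Ω (γ i) ∈ E := by
    intro i
    obtain ⟨c, hc⟩ := hγ i
    rw [mem_separableClosure_iff]
    have hc0 : c ≠ 0 := by
      rintro rfl
      simp at hc
      exact h0 i (pow_eq_zero_iff hpos.ne' |>.1 hc.symm)
    refine (separable_X_pow_sub_C c hℓ hc0).of_dvd (minpoly.dvd _ _ ?_)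
    simp only [map_sub, map_pow, aeval_X, aeval_C]
    rw [← map_pow, ← hc, ← IsScalarTower.algebraMap_apply, sub_self]
  let g : ι → E := fun i => ⟨_, hsep i⟩
  have g0 : ∀ i, g i ≠ 0 := by
    intro i h
    have := congrArg (Subtype.val) h
    simp only [g, ZeroMemClass.coe_zero, map_eq_zero] at this
    exact h0 i this
  have gℓ : ∀ i, ∃ c : P, algebraMap P E c = g i ^ ℓ := by
    intro i
    obtain ⟨c, hc⟩ := hγ i
    refine ⟨c, Subtype.ext ?_⟩
    simp only [g, SubmonoidClass.mk_pow, ← map_pow, ← hc]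
    rw [← IsScalarTower.algebraMap_apply]; rfl
  have hfix : ∀ (x : E), x ^ ℓ = 1 → ∃ c : P, algebraMap P E c = x := by
    intro x hx
    have := hζ.map_of_injective (algebraMap P E).injective
    obtain ⟨i, -, hi⟩ := this.eq_pow_of_pow_eq_one hx
    exact ⟨ζ ^ i, by rw [map_pow, hi]⟩
  have hr : ∀ i (σ : E ≃ₐ[P] E), (σ (g i) / g i) ^ ℓ = 1 := by
    intro i σ
    obtain ⟨c, hc⟩ := gℓ i
    rw [div_pow, ← map_pow, ← hc, σ.commutes, div_self]
    rw [hc]; exact pow_ne_zero _ (g0 i)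
  let χ : ι → ((E ≃ₐ[P] E) →* E) := fun i =>
    { toFun := fun σ => σ (g i) / g i
      map_one' := by simp [g0 i]
      map_mul' := by
        intro σ τ
        obtain ⟨c, hc⟩ := hfix _ (hr i τ)
        have h1 : τ (g i) = algebraMap P E c * g i := by rw [hc, div_mul_cancel₀ _ (g0 i)]
        rw [AlgEquiv.mul_apply, h1, map_mul, σ.commutes]
        field_simp [g0 i] }
  have hχ : Function.Injective χ := by
    intro i j hij
    by_contra hne
    have : g i / g j ∈ Set.range (algebraMap P E) := by
      rw [InfiniteGalois.mem_range_algebraMap_iff_fixed]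
      intro σ
      have h1 : σ (g i) / g i = σ (g j) / g j := DFunLike.congr_fun hij σ
      have := g0 i; have := g0 j
      have hs : σ (g j) ≠ 0 := by simpa using g0 j
      rw [map_div₀]
      field_simp at h1 ⊢
      linear_combination h1
    obtain ⟨c, hc⟩ := this
    apply H i j hne c
    apply (algebraMap F Ω).injective
    have := congrArg (Subtype.val) hc
    rw [← IsScalarTower.algebraMap_apply, map_div₀]
    exact this
  have hli := (linearIndependent_monoidHom (E ≃ₐ[P] E) E).comp χ hχ
  rw [linearIndependent_iff'] at hli ⊢
  intro s c hs i hi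
  have hs' : ∑ i ∈ s, c i • g i = 0 := by
    apply Subtype.ext
    have := congrArg (algebraMap F Ω) hs
    rw [map_sum, map_zero] at this
    rw [AddSubmonoidClass.coe_finsetSum]
    simp only [Algebra.smul_def, map_mul] at this ⊢
    rw [ZeroMemClass.coe_zero, ← this]
    refine Finset.sum_congr rfl fun i _ => ?_
    rw [← IsScalarTower.algebraMap_apply]; rfl
  have h2 := hli s (fun i => algebraMap P E (c i) * g i) (by
    funext σ
    have h3 := congrArg σ hs'
    simp only [map_sum, map_zero, map_smul] at h3
    rw [Finset.sum_apply, Pi.zero_apply, ← h3]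
    refine Finset.sum_congr rfl fun i _ => ?_
    simp only [Pi.smul_apply, Function.comp, smul_eq_mul, Algebra.smul_def]
    change _ * (σ (g i) / g i) = _
    field_simp [g0 i]) i hi
  simpa [g0 i] using h2

lemma exists_base (ℓ : ℕ) [Fact ℓ.Prime] {k F : Type*} [Field k] [Field F] [Algebra k F]
    [Algebra.EssFiniteType k F] (a : F) (ha : Transcendental k a) :
    ∃ P : IntermediateField k F, Module.Finite P F ∧ a ∈ P ∧
      ∀ x y : k, x ≠ y → ∀ c ∈ P,
        c ^ ℓ ≠ (a - algebraMap k F x) / (a - algebraMap k F y) := by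
  have hl2 : 1 < ℓ := (Fact.out : ℓ.Prime).one_lt
  have h1 : AlgebraicIndepOn k id ({a} : Set F) := by
    have := (algebraicIndependent_singleton_iff (R := k) (x := fun i : ({a} : Set F) => (i : F)) ⟨a, rfl⟩).2 ha
    exact this
  obtain ⟨t, hat, ht⟩ := exists_isTranscendenceBasis_superset h1
  have hat : a ∈ t := hat rfl
  refine ⟨IntermediateField.adjoin k (Set.range (Subtype.val : t → F)), ?_,
    IntermediateField.subset_adjoin _ _ ⟨⟨a, hat⟩, rfl⟩, ?_⟩
  · have := ht.isAlgebraic_field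
    have : Algebra.EssFiniteType (IntermediateField.adjoin k (Set.range (Subtype.val : t → F))) F :=
      Algebra.EssFiniteType.of_comp k _ F
    exact Algebra.finite_of_essFiniteType_of_isAlgebraic
  intro x y hxy c hc hcl
  let i : t := ⟨a, hat⟩
  have htr := ht.1.transcendental_adjoin (s := {i}ᶜ) (i := i) (by simp)
  set A := Algebra.adjoin k ((Subtype.val : t → F) '' {i}ᶜ) with hA
  have htr : Transcendental A a := htr
  have hinj : Function.Injective (aeval (R := A) a) := transcendental_iff_injective.1 htr
  have hmem : ∀ r ∈ Algebra.adjoin k (Set.range (Subtype.val : t → F)), ∃ f : A[X], aeval a f = r := by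
    intro r hr
    have : Algebra.adjoin k (Set.range (Subtype.val : t → F)) ≤ ((aeval (R := A) a).restrictScalars k).range := by
      rw [Algebra.adjoin_le_iff]
      rintro _ ⟨j, rfl⟩
      by_cases hj : j = i
      · exact ⟨X, by subst hj; simp [i]⟩
      · refine ⟨C ⟨j, Algebra.subset_adjoin ⟨j, by simpa using hj, rfl⟩⟩, ?_⟩
        change aeval a (C _) = _
        rw [aeval_C]
        rfl
    exact this hr
  obtain ⟨r, hr, s, hs, rfl⟩ := IntermediateField.mem_adjoin_iff_div.1 hc
  obtain ⟨f, rfl⟩ := hmem r hr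
  obtain ⟨g, rfl⟩ := hmem s hs
  have hne : ∀ z : k, a - algebraMap k F z ≠ 0 := by
    intro z hz
    apply ha
    rw [sub_eq_zero.1 hz]
    exact isAlgebraic_algebraMap z
  have hc0 : aeval (R := A) a f / aeval a g ≠ 0 := by
    intro h
    rw [h, zero_pow (by omega)] at hcl
    exact div_ne_zero (hne x) (hne y) hcl.symm
  have hf : aeval a f ≠ 0 := fun h => hc0 (by simp [h])
  have hg : aeval a g ≠ 0 := fun h => hc0 (by simp [h])
  have key : f ^ ℓ * (X - C (algebraMap k A y)) = g ^ ℓ * (X - C (algebraMap k A x)) := by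
    apply hinj
    have h1 := hne x
    have h2 := hne y
    have e : ∀ z, algebraMap A F (algebraMap k A z) = algebraMap k F z := fun z => rfl
    simp only [map_mul, map_pow, map_sub, aeval_X, aeval_C, e]
    rw [div_pow] at hcl
    have h3 := pow_ne_zero ℓ hg
    rw [div_eq_div_iff h3 h2] at hcl
    linear_combination hcl
  have hf0 : f ≠ 0 := by rintro rfl; simp at hf
  have hg0 : g ≠ 0 := by rintro rfl; simp at hg
  have hpow : ∀ (h : A[X]) (z : A), h ≠ 0 → ∀ n, rootMultiplicity z (h ^ n) = n * rootMultiplicity z h := by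
    intro h z h0 n
    induction n with
    | zero => simp [← C_1, -map_one]
    | succ n ih =>
      rw [pow_succ, rootMultiplicity_mul (mul_ne_zero (pow_ne_zero _ h0) h0), ih]; ring
  classical
  have := congrArg (rootMultiplicity (algebraMap k A x)) key
  rw [rootMultiplicity_mul (mul_ne_zero (pow_ne_zero _ hf0) (X_sub_C_ne_zero _)),
    rootMultiplicity_mul (mul_ne_zero (pow_ne_zero _ hg0) (X_sub_C_ne_zero _)),
    hpow _ _ hf0, hpow _ _ hg0, rootMultiplicity_X_sub_C, rootMultiplicity_X_sub_C, if_pos rfl,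
    if_neg (fun h => hxy ((algebraMap k A).injective h))] at this
  have h2 := congrArg (· % ℓ) this
  simp [Nat.mod_eq_of_lt hl2] at h2

lemma exists_not_pow (ℓ : ℕ) [Fact ℓ.Prime] {k F : Type*} [Field k] [Field F] [Algebra k F]
    [IsAlgClosed k] (hℓ : (ℓ : k) ≠ 0)
    [Algebra.EssFiniteType k F] (a : F) (ha : Transcendental k a) (S : Set k) (hS : S.Infinite) :
    ∃ x ∈ S, ∃ y ∈ S, x ≠ y ∧
      ∀ z : F, z ^ ℓ ≠ (a - algebraMap k F x) / (a - algebraMap k F y) := by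
  obtain ⟨P, hfin, haP, hP⟩ := exists_base ℓ a ha
  by_contra! H
  have hpos : 0 < ℓ := (Fact.out : ℓ.Prime).pos
  have : NeZero (ℓ : k) := ⟨hℓ⟩
  obtain ⟨ζ, hζ⟩ := HasEnoughRootsOfUnity.exists_primitiveRoot k ℓ
  obtain ⟨x₀, hx₀⟩ := hS.nonempty
  have hne : ∀ z : k, a - algebraMap k F z ≠ 0 := by
    intro z hz
    apply ha
    rw [sub_eq_zero.1 hz]
    exact isAlgebraic_algebraMap z
  have : Infinite (S \ {x₀} : Set k) := (hS.sdiff (Set.finite_singleton x₀)).to_subtype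
  have H' : ∀ x : (S \ {x₀} : Set k), ∃ z : F, z ^ ℓ = (a - algebraMap k F x) / (a - algebraMap k F x₀) :=
    fun x => H x x.2.1 x₀ hx₀ x.2.2
  choose γ hγ using H'
  have γ0 : ∀ i, γ i ≠ 0 := by
    intro i h
    have := hγ i
    rw [h, zero_pow hpos.ne'] at this
    exact div_ne_zero (hne _) (hne _) this.symm
  obtain ⟨i, j, hij, c, hc⟩ := kummer_indep (P := P) ℓ
    (by intro h; apply hℓ; apply (algebraMap k P).injective; simpa using h)
    (algebraMap k P ζ)
    (hζ.map_of_injective (algebraMap k P).injective) γ γ0 (by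
      intro i
      refine ⟨⟨_, div_mem (sub_mem haP (P.algebraMap_mem i)) (sub_mem haP (P.algebraMap_mem x₀))⟩, ?_⟩
      rw [hγ]; rfl)
  refine hP i j (fun h => hij (Subtype.ext h)) c c.2 ?_
  change (algebraMap P F c) ^ ℓ = _
  rw [hc, div_pow, hγ, hγ, div_div_div_cancel_right₀ (hne _)]


lemma prod_range {R : Type*} [Field R] {n : ℕ} (hn : 0 < n) {ζ : R} (hζ : IsPrimitiveRoot ζ n)
    (x y : R) : x ^ n - y ^ n = ∏ i ∈ Finset.range n, (x - ζ ^ i * y) := by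
  have : NeZero n := ⟨hn.ne'⟩
  rw [hζ.pow_sub_pow_eq_prod_sub_mul x y hn]
  symm
  refine Finset.prod_nbij (fun i => ζ ^ i) ?_ ?_ ?_ ?_
  · intro i _
    rw [mem_nthRootsFinset hn, ← pow_mul, mul_comm, pow_mul, hζ.pow_eq_one, one_pow]
  · intro i hi j hj h
    exact hζ.pow_inj (by simpa using hi) (by simpa using hj) h
  · intro η hη
    obtain ⟨i, hi, h⟩ := hζ.eq_pow_of_pow_eq_one ((mem_nthRootsFinset hn _).1 (by simpa using hη))
    exact ⟨i, by simpa using hi, h⟩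
  · intros; rfl

section
variable {ℓ : ℕ} [Fact ℓ.Prime] {K L : Type*} [Field K] [Field L] [Algebra K L]

lemma root_mem (ζ : K) (hζ : IsPrimitiveRoot ζ ℓ) (x : L) (hx : x ^ ℓ = 1) :
    ∃ c : K, algebraMap K L c = x := by
  have : NeZero ℓ := ⟨(Fact.out : ℓ.Prime).ne_zero⟩
  have := hζ.map_of_injective (algebraMap K L).injective
  obtain ⟨i, -, hi⟩ := this.eq_pow_of_pow_eq_one hx
  exact ⟨ζ ^ i, by rw [map_pow, hi]⟩

lemma pow_apply_root (τ : L ≃ₐ[K] L) (α : L) (c : K) (h : τ α = algebraMap K L c * α) (n : ℕ) :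
    (τ ^ n) α = algebraMap K L c ^ n * α := by
  induction n with
  | zero => simp
  | succ n ih =>
    rw [pow_succ', AlgEquiv.mul_apply, ih, map_mul, map_pow, τ.commutes, h]; ring

lemma exists_kummer_elt [Algebra.IsAlgebraic K L] (hℓ : (ℓ : L) ≠ 0)
    (ζ : K) (hζ : IsPrimitiveRoot ζ ℓ) (N : Subgroup (L ≃ₐ[K] L))
    (hab : ∀ a ∈ N, ∀ b ∈ N, a * b = b * a)
    (hpow : ∀ (σ : L ≃ₐ[K] L) (y : L), ∃ n : ℕ, (σ ^ ℓ ^ n) y = y) (hN : N ≠ ⊥) :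
    ∃ v : L, (∃ τ ∈ N, τ v ≠ v) ∧ ∀ τ ∈ N, τ (v ^ ℓ) = v ^ ℓ := by
  have hp : ℓ.Prime := Fact.out
  let Bad : Set L := {x | ∃ τ ∈ N, τ x ≠ x}
  have hBad : Bad.Nonempty := by
    by_contra h
    apply hN
    rw [Subgroup.eq_bot_iff_forall]
    intro τ hτ
    ext x
    by_contra hx
    exact h ⟨x, τ, hτ, hx⟩
  obtain ⟨x, ⟨τ, hτ, hτx⟩, hmin⟩ := WellFounded.has_min
    (measure (fun x : L => (MulAction.stabilizer N x).index)).wf Bad hBad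
  have hfi : (MulAction.stabilizer N x).FiniteIndex := by
    refine ⟨?_⟩
    rw [MulAction.index_stabilizer]
    have hfin : (MulAction.orbit N x).Finite := by
      refine ((minpoly K x).rootSet_finite L).subset ?_
      rintro _ ⟨σ, rfl⟩
      have hint : IsIntegral K x := Algebra.IsIntegral.isIntegral x
      rw [mem_rootSet]
      refine ⟨minpoly.ne_zero hint, ?_⟩
      change aeval ((σ : L ≃ₐ[K] L) x) _ = 0
      rw [← AlgEquiv.coe_toAlgHom, aeval_algHom_apply, minpoly.aeval, map_zero]
    rw [Ne, Set.ncard_eq_zero hfin]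
    exact (MulAction.nonempty_orbit x).ne_empty
  have hmin' : ∀ (σ : L ≃ₐ[K] L), σ ∈ N → σ x ≠ x → ∀ y : L,
      (∀ ρ ∈ N, ρ x = x → ρ y = y) → σ y = y → ∀ ρ ∈ N, ρ y = y := by
    intro σ hσ hσx y h1 h2
    by_contra! h3
    refine hmin y h3 (Subgroup.index_strictAnti (lt_of_le_of_ne ?_ ?_))
    · intro ρ hρ
      exact h1 ρ ρ.2 hρ
    · intro h
      have : (⟨σ, hσ⟩ : N) ∈ MulAction.stabilizer N y := h2
      rw [← h] at this
      exact hσx this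
  classical
  have hex := hpow τ x
  let n := Nat.find hex
  have hn : (τ ^ ℓ ^ n) x = x := Nat.find_spec hex
  have hn0 : n ≠ 0 := by
    intro h
    rw [h] at hn
    simp at hn
    exact hτx hn
  obtain ⟨m, hm⟩ := Nat.exists_eq_succ_of_ne_zero hn0
  have hσx : (τ ^ ℓ ^ m) x ≠ x := Nat.find_min hex (m := m) (by omega)
  set σ := τ ^ ℓ ^ m with hσdef
  have hσN : σ ∈ N := N.pow_mem hτ _
  have hσℓ : (σ ^ ℓ) x = x := by rw [hσdef, ← pow_mul, ← pow_succ, ← Nat.succ_eq_add_one, ← hm, hn]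
  set z := algebraMap K L ζ with hz
  have hzp : IsPrimitiveRoot z ℓ := hζ.map_of_injective (algebraMap K L).injective
  have hσz : ∀ (ρ : L ≃ₐ[K] L), ρ z = z := fun ρ => ρ.commutes ζ
  let V : ℕ → L := fun j => ∑ i ∈ Finset.range ℓ, z ^ (i * j) * (σ ^ i) x
  have hV : ∀ j, z ^ j * σ (V j) = V j := by
    intro j
    have h1 : z ^ j * σ (V j) = ∑ i ∈ Finset.range ℓ, z ^ ((i + 1) * j) * (σ ^ (i + 1)) x := by
      simp only [V, map_sum, Finset.mul_sum, map_mul, map_pow, hσz]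
      refine Finset.sum_congr rfl fun i _ => ?_
      rw [pow_succ' σ, AlgEquiv.mul_apply]; ring
    have h2 := Finset.sum_range_succ (fun i => z ^ (i * j) * (σ ^ i) x) ℓ
    rw [Finset.sum_range_succ'] at h2
    have h3 : z ^ (ℓ * j) = 1 := by rw [pow_mul, hzp.pow_eq_one, one_pow]
    rw [h3, hσℓ] at h2
    simp only [zero_mul, pow_zero, AlgEquiv.one_apply] at h2
    rw [h1]
    exact add_right_cancel h2
  have hVS : ∀ j, ∀ ρ ∈ N, ρ x = x → ρ (V j) = V j := by
    intro j ρ hρ hρx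
    simp only [V, map_sum, map_mul, map_pow, hσz]
    refine Finset.sum_congr rfl fun i _ => ?_
    rw [← AlgEquiv.mul_apply, hab ρ hρ _ (N.pow_mem hσN i), AlgEquiv.mul_apply, hρx]
  have hsum : ∑ j ∈ Finset.range ℓ, V j = ℓ * x := by
    simp only [V]
    rw [Finset.sum_comm]
    simp only [← Finset.sum_mul]
    rw [Finset.sum_eq_single 0]
    · simp
    · intro i hi hi0
      have hi' : i < ℓ := by simpa using hi
      have hcop : i.Coprime ℓ :=
        (Nat.coprime_of_lt_prime (by omega) hi' hp).symm
      have := (hzp.pow_of_coprime i hcop).geom_sum_eq_zero hp.one_lt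
      simp only [pow_mul]
      rw [this, zero_mul]
    · simp [hp.ne_zero]
  obtain ⟨j, hj, hj0, hVj⟩ : ∃ j, j < ℓ ∧ j ≠ 0 ∧ V j ≠ 0 := by
    by_contra! h
    rw [Finset.sum_eq_single 0 (fun j hj hj0 => h j (by simpa using hj) hj0)
      (by simp [hp.ne_zero])] at hsum
    have h0 := hV 0
    rw [hsum] at h0
    simp only [pow_zero, one_mul, map_mul, map_natCast] at h0
    exact hσx (mul_left_cancel₀ hℓ h0)
  refine ⟨V j, ⟨σ, hσN, ?_⟩, hmin' σ hσN hσx _ ?_ ?_⟩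
  · intro h
    have h1 := hV j
    rw [h] at h1
    have h2 : z ^ j = 1 := mul_right_cancel₀ hVj (by rw [h1, one_mul])
    exact hzp.pow_ne_one_of_pos_of_lt hj0 hj h2
  · intro ρ hρ hρx
    rw [map_pow, hVS j ρ hρ hρx]
  · have h1 := congrArg (· ^ ℓ) (hV j)
    simp only [mul_pow] at h1
    rw [← pow_mul, mul_comm j, pow_mul, hzp.pow_eq_one, one_pow, one_mul, ← map_pow] at h1
    exact h1

lemma prim_of_ne_one {R : Type*} [Field R] (ω : R) (h : ω ^ ℓ = 1) (h1 : ω ≠ 1) :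
    IsPrimitiveRoot ω ℓ := by
  rw [IsPrimitiveRoot.iff_orderOf]
  exact orderOf_eq_prime h h1

lemma rigid (ζ κ : K) (hζ : IsPrimitiveRoot ζ ℓ) (hκ : κ ^ ℓ = -1) (N : Subgroup (L ≃ₐ[K] L))
    (hab : ∀ a ∈ N, ∀ b ∈ N, a * b = b * a)
    (hroot : ∀ y : L, ∃ r, r ^ ℓ = y) (a : L) (ha : ∀ τ ∈ N, τ a = a)
    (hT : ¬ ∃ m : L, (∀ τ ∈ N, τ m = m) ∧ m ^ ℓ = a) (e : K) :
    ∃ j, j < ℓ ∧ ∃ m : L, (∀ τ ∈ N, τ m = m) ∧ a - algebraMap K L e ^ ℓ = a ^ j * m ^ ℓ := by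
  have hp : ℓ.Prime := Fact.out
  have : NeZero ℓ := ⟨hp.ne_zero⟩
  obtain ⟨α, rfl⟩ := hroot a
  obtain ⟨β, hβ⟩ := hroot (algebraMap K L e - α)
  obtain ⟨τ, hτ, hτα⟩ : ∃ τ ∈ N, τ α ≠ α := by
    by_contra! h
    exact hT ⟨α, h, rfl⟩
  have hα0 : α ≠ 0 := by rintro rfl; simp at hτα
  have hβ0 : β ≠ 0 := by
    rintro rfl
    rw [zero_pow hp.ne_zero] at hβ
    apply hτα
    rw [← sub_eq_zero.1 hβ.symm, τ.commutes]
  have hrα : ∀ σ ∈ N, (σ α / α) ^ ℓ = 1 := by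
    intro σ hσ
    rw [div_pow, ← map_pow, ha σ hσ, div_self (pow_ne_zero _ hα0)]
  obtain ⟨w, hw⟩ := root_mem (L := L) ζ hζ _ (hrα τ hτ)
  have hτα' : τ α = algebraMap K L w * α := by rw [hw, div_mul_cancel₀ _ hα0]
  have hprim : IsPrimitiveRoot (algebraMap K L w) ℓ := by
    apply prim_of_ne_one
    · rw [hw, hrα τ hτ]
    · intro h; rw [h, one_mul] at hτα'; exact hτα hτα'
  set ω := algebraMap K L w with hω
  have hfω : ∀ (ρ : L ≃ₐ[K] L), ρ ω = ω := fun ρ => ρ.commutes w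
  have hτi : ∀ i, (τ ^ i) α = ω ^ i * α := pow_apply_root τ α w hτα'
  let B := ∏ i ∈ Finset.range ℓ, (τ ^ i) β
  have hB : B ^ ℓ = algebraMap K L e ^ ℓ - α ^ ℓ := by
    rw [prod_range hp.pos hprim, ← Finset.prod_pow]
    refine Finset.prod_congr rfl fun i _ => ?_
    rw [← map_pow, hβ, map_sub, AlgEquiv.commutes, hτi]
  have hrβ : ∀ σ : L ≃ₐ[K] L, σ α = α → (σ β / β) ^ ℓ = 1 := by
    intro σ hσ
    rw [div_pow, ← map_pow, hβ, map_sub, hσ, σ.commutes, div_self]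
    rw [← hβ]; exact pow_ne_zero _ hβ0
  have hBS : ∀ σ ∈ N, σ α = α → σ B = B := by
    intro σ hσ hσα
    obtain ⟨c, hc⟩ := root_mem (L := L) ζ hζ _ (hrβ σ hσα)
    have h1 : σ β = algebraMap K L c * β := by rw [hc, div_mul_cancel₀ _ hβ0]
    have h2 : ∀ i ∈ Finset.range ℓ, σ ((τ ^ i) β) = algebraMap K L c * (τ ^ i) β := by
      intro i _
      rw [← AlgEquiv.mul_apply, hab σ hσ _ (N.pow_mem hτ i), AlgEquiv.mul_apply, h1, map_mul,
        AlgEquiv.commutes]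
    simp only [B]
    rw [map_prod, Finset.prod_congr rfl h2, Finset.prod_mul_distrib, Finset.prod_const,
      Finset.card_range, hc, hrβ σ hσα, one_mul]
  have hτB : τ B * β = B * (τ ^ ℓ) β := by
    have h2 := Finset.prod_range_succ (fun i => (τ ^ i) β) ℓ
    rw [Finset.prod_range_succ'] at h2
    simp only [B, map_prod]
    rw [← h2]
    simp only [pow_succ' τ, AlgEquiv.mul_apply, pow_zero, AlgEquiv.one_apply]
  have hτℓ : (τ ^ ℓ) α = α := by rw [hτi, hprim.pow_eq_one, one_mul]
  obtain ⟨j, hj, hj'⟩ := hprim.eq_pow_of_pow_eq_one (hrβ _ hτℓ)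
  have hτB' : τ B = ω ^ j * B := by
    have h1 : (τ ^ ℓ) β = ω ^ j * β := by rw [hj', div_mul_cancel₀ _ hβ0]
    rw [h1] at hτB
    apply mul_right_cancel₀ hβ0
    rw [hτB]; ring
  have hω0 : ω ≠ 0 := hprim.ne_zero hp.ne_zero
  have hm : ∀ σ ∈ N, σ (B / α ^ j) = B / α ^ j := by
    have hτm : τ (B / α ^ j) = B / α ^ j := by
      rw [map_div₀, map_pow, hτB', hτα', mul_pow]
      field_simp
    have hτm' : ∀ i, (τ ^ i) (B / α ^ j) = B / α ^ j := by
      intro i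
      have := pow_apply_root τ (B / α ^ j) 1 (by simpa using hτm) i
      simpa using this
    intro σ hσ
    obtain ⟨i, hi, hi'⟩ := hprim.eq_pow_of_pow_eq_one (hrα σ hσ)
    have h1 : σ α = (τ ^ i) α := by rw [hτi, hi', div_mul_cancel₀ _ hα0]
    have h2 : ((τ ^ i)⁻¹ * σ) α = α := by
      rw [AlgEquiv.mul_apply, h1, ← AlgEquiv.mul_apply, inv_mul_cancel, AlgEquiv.one_apply]
    have hmem : (τ ^ i)⁻¹ * σ ∈ N := N.mul_mem (N.inv_mem (N.pow_mem hτ i)) hσ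
    have h3 : ((τ ^ i)⁻¹ * σ) (B / α ^ j) = B / α ^ j := by
      rw [map_div₀, map_pow, h2, hBS _ hmem h2]
    calc σ (B / α ^ j) = (τ ^ i * ((τ ^ i)⁻¹ * σ)) (B / α ^ j) := by rw [mul_inv_cancel_left]
      _ = _ := by rw [AlgEquiv.mul_apply, h3, hτm']
  refine ⟨j, hj, algebraMap K L κ * (B / α ^ j), ?_, ?_⟩
  · intro σ hσ
    rw [map_mul, hm σ hσ, σ.commutes]
  · have h1 : algebraMap K L κ ^ ℓ = -1 := by rw [← map_pow, hκ, map_neg, map_one]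
    rw [mul_pow, h1, div_pow, hB, ← pow_mul, ← pow_mul, mul_comm ℓ j]
    field_simp
    ring

end

section
variable {ℓ : ℕ} [Fact ℓ.Prime] {k K L : Type*} [Field k] [Field K] [Field L]
  [Algebra k K] [Algebra K L] [Algebra k L] [IsScalarTower k K L]

/-- being the `ℓ`-th power of an element fixed by `N` -/
def T (ℓ : ℕ) (N : Subgroup (L ≃ₐ[K] L)) (x : L) : Prop :=
  ∃ m : L, (∀ τ ∈ N, τ m = m) ∧ m ^ ℓ = x

lemma T.mul {N : Subgroup (L ≃ₐ[K] L)} {x y : L} (hx : T ℓ N x) (hy : T ℓ N y) :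
    T ℓ N (x * y) := by
  obtain ⟨m, h, rfl⟩ := hx
  obtain ⟨n, h', rfl⟩ := hy
  exact ⟨m * n, fun τ hτ => by rw [map_mul, h τ hτ, h' τ hτ], mul_pow _ _ _⟩

lemma T.zpow {N : Subgroup (L ≃ₐ[K] L)} {x : L} (hx : T ℓ N x) (n : ℤ) :
    T ℓ N (x ^ n) := by
  obtain ⟨m, h, rfl⟩ := hx
  refine ⟨m ^ n, fun τ hτ => by rw [map_zpow₀, h τ hτ], ?_⟩
  rw [← zpow_natCast, ← zpow_natCast, ← zpow_mul, ← zpow_mul, mul_comm]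

lemma T.inv {N : Subgroup (L ≃ₐ[K] L)} {x : L} (hx : T ℓ N x) : T ℓ N x⁻¹ := by
  simpa using hx.zpow (-1)

lemma T.one {N : Subgroup (L ≃ₐ[K] L)} : T ℓ N 1 := ⟨1, by simp, by simp⟩

lemma T.prod {N : Subgroup (L ≃ₐ[K] L)} {ι : Type*} (s : Finset ι) (f : ι → L)
    (h : ∀ i ∈ s, T ℓ N (f i)) : T ℓ N (∏ i ∈ s, f i) := by
  classical
  induction s using Finset.induction_on with
  | empty => simpa using T.one
  | insert i s hi ih =>
    rw [Finset.prod_insert hi]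
    exact (h i (by simp)).mul (ih fun j hj => h j (by simp [hj]))

lemma T.map {N : Subgroup (L ≃ₐ[K] L)} (hN : N.Normal) {x : L} (hx : T ℓ N x)
    (g : L ≃ₐ[K] L) : T ℓ N (g x) := by
  obtain ⟨m, h, rfl⟩ := hx
  refine ⟨g m, fun τ hτ => ?_, by rw [map_pow]⟩
  have h1 : g⁻¹ * τ * g ∈ N := by simpa using hN.conj_mem τ hτ g⁻¹
  have h2 := congrArg g (h _ h1)
  rw [← AlgEquiv.mul_apply, mul_assoc, mul_inv_cancel_left, AlgEquiv.mul_apply] at h2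
  exact h2

lemma T.const [IsAlgClosed k] (N : Subgroup (L ≃ₐ[K] L)) (c : k) :
    T ℓ N (algebraMap k L c) := by
  obtain ⟨e, rfl⟩ := IsAlgClosed.exists_pow_nat_eq c (Fact.out : ℓ.Prime).pos
  refine ⟨algebraMap k L e, fun τ _ => ?_, by rw [map_pow]⟩
  rw [IsScalarTower.algebraMap_apply k K L, τ.commutes]

lemma mem_range_of_isAlgebraic {F : Type*} [Field F] [Algebra k F] [IsAlgClosed k] (a : F)
    (ha : IsAlgebraic k a) : ∃ c : k, algebraMap k F c = a :=
  minpoly.mem_range_of_degree_eq_one k a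
    (IsAlgClosed.degree_eq_one_of_irreducible k (minpoly.irreducible ha.isIntegral))

theorem core [IsAlgClosed k] (hℓ : (ℓ : k) ≠ 0) [Algebra.EssFiniteType k K] [IsGalois K L]
    (hroot : ∀ y : L, ∃ r, r ^ ℓ = y)
    (hpow : ∀ (σ : L ≃ₐ[K] L) (y : L), ∃ n : ℕ, (σ ^ ℓ ^ n) y = y)
    (N : Subgroup (L ≃ₐ[K] L)) (hnorm : N.Normal)
    (hab : ∀ a ∈ N, ∀ b ∈ N, a * b = b * a) : N = ⊥ := by
  have hp : ℓ.Prime := Fact.out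
  have : NeZero ℓ := ⟨hp.ne_zero⟩
  have : NeZero (ℓ : k) := ⟨hℓ⟩
  obtain ⟨ζ₀, hζ₀⟩ := HasEnoughRootsOfUnity.exists_primitiveRoot k ℓ
  obtain ⟨κ₀, hκ₀⟩ := IsAlgClosed.exists_pow_nat_eq (-1 : k) hp.pos
  have hζ : IsPrimitiveRoot (algebraMap k K ζ₀) ℓ :=
    hζ₀.map_of_injective (algebraMap k K).injective
  have hκ : (algebraMap k K κ₀) ^ ℓ = -1 := by rw [← map_pow, hκ₀, map_neg, map_one]
  by_contra hN
  obtain ⟨v, ⟨τ, hτ, hτv⟩, hv⟩ := exists_kummer_elt (by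
    intro h; apply hℓ; apply (algebraMap k L).injective; simpa using h) _ hζ N hab hpow hN
  have hrig : ∀ b : L, (∀ τ ∈ N, τ b = b) → ¬ T ℓ N b → ∀ c : k, ∃ j, j < ℓ ∧
      ∃ m : L, (∀ τ ∈ N, τ m = m) ∧ b - algebraMap k L c = b ^ j * m ^ ℓ := by
    intro b hb hTb c
    obtain ⟨e, rfl⟩ := IsAlgClosed.exists_pow_nat_eq c hp.pos
    have := rigid _ _ hζ hκ N hab hroot b hb hTb (algebraMap k K e)
    rwa [← IsScalarTower.algebraMap_apply, ← map_pow] at this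
  obtain ⟨a, ha⟩ : ∃ a, a = v ^ ℓ := ⟨_, rfl⟩
  have haN : ∀ τ ∈ N, τ a = a := by rw [ha]; exact hv
  have haT : ¬ T ℓ N a := by
    rintro ⟨m, hm, hma⟩
    have hv0 : v ≠ 0 := by rintro rfl; simp at hτv
    have hm0 : m ≠ 0 := by
      rintro rfl
      rw [ha, zero_pow hp.ne_zero] at hma
      exact pow_ne_zero _ hv0 hma.symm
    obtain ⟨c, hc⟩ := root_mem (L := L) _ hζ (v / m) (by
      rw [div_pow, hma, ha, div_self (pow_ne_zero _ hv0)])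
    have : v = algebraMap K L c * m := by rw [hc, div_mul_cancel₀ _ hm0]
    apply hτv
    rw [this, map_mul, τ.commutes, hm τ hτ]
  have hane : ∀ c : k, a - algebraMap k L c ≠ 0 := by
    intro c h
    apply haT
    rw [sub_eq_zero.1 h]
    exact T.const N c
  choose f hf m hm hfm using hrig a haN haT
  obtain ⟨j, hj⟩ := Finite.exists_infinite_fiber (fun c : k => (⟨f c, hf c⟩ : Fin ℓ))
  let K₀ := IntermediateField.adjoin K {a}
  let a₀ : K₀ := IntermediateField.AdjoinSimple.gen K a
  have : Module.Finite K K₀ := IntermediateField.adjoin.finiteDimensional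
    (Algebra.IsIntegral.isIntegral a)
  have : Algebra.EssFiniteType k K₀ := Algebra.EssFiniteType.comp k K K₀
  have ha₀ : algebraMap K₀ L a₀ = a := rfl
  have hcomm : ∀ c : k, algebraMap K₀ L (algebraMap k K₀ c) = algebraMap k L c := fun c => by
    rw [IsScalarTower.algebraMap_apply k K K₀, ← IsScalarTower.algebraMap_apply K K₀ L,
      ← IsScalarTower.algebraMap_apply]
  have htr : Transcendental k a₀ := by
    intro h
    obtain ⟨c, hc⟩ := mem_range_of_isAlgebraic a₀ h
    apply hane c
    rw [← ha₀, ← hc, hcomm, sub_self]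
  obtain ⟨x, hx, y, hy, hxy, hz⟩ := exists_not_pow ℓ hℓ a₀ htr _ (Set.infinite_coe_iff.1 hj)
  have hfxy : f x = f y := by
    have h1 : (⟨f x, hf x⟩ : Fin ℓ) = j := hx
    have h2 : (⟨f y, hf y⟩ : Fin ℓ) = j := hy
    rw [← h2] at h1
    exact congrArg Fin.val h1
  obtain ⟨u, hu⟩ : ∃ u, u = (a - algebraMap k L x) / (a - algebraMap k L y) := ⟨_, rfl⟩
  obtain ⟨z, hzdef⟩ : ∃ z, z = m x / m y := ⟨_, rfl⟩
  have ha0 : a ≠ 0 := by simpa using hane 0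
  have hzu : z ^ ℓ = u := by
    rw [hzdef, hu, hfm, hfm, hfxy, div_pow, mul_div_mul_left _ _ (pow_ne_zero _ ha0)]
  have hzN : ∀ τ ∈ N, τ z = z := by
    intro τ hτ
    rw [hzdef, map_div₀, hm x τ hτ, hm y τ hτ]
  have hu0 : u ≠ 0 := by rw [hu]; exact div_ne_zero (hane x) (hane y)
  have hz0 : z ≠ 0 := by rintro rfl; rw [zero_pow hp.ne_zero] at hzu; exact hu0 hzu.symm
  have hzK : z ∉ Set.range (algebraMap K₀ L) := by
    rintro ⟨z', hz'⟩
    apply hz z'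
    apply (algebraMap K₀ L).injective
    rw [map_pow, hz', hzu, hu, map_div₀, map_sub, map_sub, ha₀, hcomm, hcomm]
  rw [InfiniteGalois.mem_range_algebraMap_iff_fixed] at hzK
  push Not at hzK
  obtain ⟨g₀, hg₀⟩ := hzK
  obtain ⟨g, hg⟩ : ∃ g : L ≃ₐ[K] L, ∀ x, g x = g₀ x := ⟨g₀.restrictScalars K, fun _ => rfl⟩
  have hgz : g z ≠ z := by rw [hg]; exact hg₀
  have hgk : ∀ (g : L ≃ₐ[K] L) (c : k), g (algebraMap k L c) = algebraMap k L c := by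
    intro g c
    rw [IsScalarTower.algebraMap_apply k K L, g.commutes]
  have hga : g a = a := by rw [hg, ← ha₀, g₀.commutes]
  have hgu : g u = u := by rw [hu, map_div₀, map_sub, map_sub, hga, hgk, hgk]
  have hgiu : ∀ i, (g ^ i) u = u := by
    intro i
    simpa using pow_apply_root g u 1 (by simpa using hgu) i
  have hrz : (g z / z) ^ ℓ = 1 := by rw [div_pow, ← map_pow, hzu, hgu, div_self hu0]
  obtain ⟨w, hw⟩ := root_mem (L := L) ζ₀ hζ₀ _ hrz
  have hw' : g z = algebraMap K L (algebraMap k K w) * z := by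
    rw [← IsScalarTower.algebraMap_apply, hw, div_mul_cancel₀ _ hz0]
  have hwL : IsPrimitiveRoot (algebraMap k L w) ℓ := by
    apply prim_of_ne_one
    · rw [hw, hrz]
    · intro h
      rw [← IsScalarTower.algebraMap_apply, h, one_mul] at hw'
      exact hgz hw'
  have hw0 : algebraMap k L w ≠ 0 := hwL.ne_zero hp.ne_zero
  have hgi : ∀ i, (g ^ i) z = algebraMap k L w ^ i * z := by
    intro i
    rw [pow_apply_root g z _ hw' i, ← IsScalarTower.algebraMap_apply]
  -- a constant with `u - ν` not in `T`
  obtain ⟨ν, hν⟩ : ∃ ν : k, ¬ T ℓ N (u - algebraMap k L ν) := by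
    by_contra! h
    have hxyL : algebraMap k L y - algebraMap k L x ≠ 0 := by
      rw [← map_sub]
      exact (_root_.map_ne_zero _).2 (sub_ne_zero.2 hxy.symm)
    have h1 : T ℓ N (a - algebraMap k L y) := by
      have e : a - algebraMap k L y = algebraMap k L (y - x) * (u - algebraMap k L 1)⁻¹ := by
        have : u - algebraMap k L 1 = (algebraMap k L y - algebraMap k L x) / (a - algebraMap k L y) := by
          rw [hu, map_one, eq_div_iff (hane y), sub_mul, div_mul_cancel₀ _ (hane y)]; ring
        rw [this, map_sub, inv_div, mul_div_cancel₀ _ hxyL]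
      rw [e]
      exact (T.const N _).mul (h 1).inv
    by_cases hy0 : y = 0
    · apply haT
      simpa [hy0] using h1
    · apply haT
      have hyL : algebraMap k L y ≠ 0 := (_root_.map_ne_zero _).2 hy0
      have e : a = (a - algebraMap k L y) * algebraMap k L (y / (y - x)) *
          (u - algebraMap k L (x / y)) := by
        have h3 := hane y
        rw [hu, map_div₀, map_div₀, map_sub]
        field_simp
        ring
      rw [e]
      exact (h1.mul (T.const N _)).mul (h _)
  obtain ⟨ε, rfl⟩ := IsAlgClosed.exists_pow_nat_eq ν hp.pos
  obtain ⟨W, hW⟩ : ∃ W, W = algebraMap k L (ε ^ ℓ) - u := ⟨_, rfl⟩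
  have hWT : ¬ T ℓ N W := by
    intro h
    apply hν
    have := (T.const N (-1 : k)).mul h
    rw [hW, map_neg, map_one, neg_one_mul, neg_sub] at this
    exact this
  have hW0 : W ≠ 0 := by
    intro h
    apply hWT
    rw [h]
    exact ⟨0, by simp, zero_pow hp.ne_zero⟩
  obtain ⟨q, hq⟩ : ∃ q, q = algebraMap k L ε - z := ⟨_, rfl⟩
  have hqN : ∀ τ ∈ N, τ q = q := by
    intro τ hτ
    rw [hq, map_sub, hgk, hzN τ hτ]
  have hgq : ∀ i, (g ^ i) q = algebraMap k L ε - algebraMap k L w ^ i * z := by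
    intro i
    rw [hq, map_sub, hgk, hgi]
  have hWprod : W = ∏ i ∈ Finset.range ℓ, (g ^ i) q := by
    rw [hW, map_pow, ← hzu, prod_range hp.pos hwL]
    exact Finset.prod_congr rfl fun i _ => (hgq i).symm
  have hgW : ∀ i, (g ^ i) W = W := by
    intro i
    rw [hW, map_sub, hgk, hgiu]
  have hqT : ¬ T ℓ N q := by
    intro h
    apply hWT
    rw [hWprod]
    exact T.prod _ _ fun i _ => h.map hnorm _
  have hgq' : ∀ i, ∃ j : ℕ, ∃ t : L, T ℓ N t ∧ (g ^ i) q = q ^ j * t := by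
    intro i
    obtain ⟨j, -, m, hm, hjm⟩ := hrig q hqN hqT (ε - (w ^ i)⁻¹ * ε)
    refine ⟨j, m ^ ℓ * algebraMap k L (w ^ i), T.mul ⟨m, hm, rfl⟩ (T.const N _), ?_⟩
    rw [← mul_assoc, ← hjm, hgq, hq]
    simp only [map_sub, map_mul, map_inv₀, map_pow]
    have := pow_ne_zero i hw0
    field_simp
    ring
  choose J t ht hJ using hgq'
  have hq0 : q ≠ 0 := by
    rintro h
    apply hqT
    rw [h]
    exact ⟨0, by simp, zero_pow hp.ne_zero⟩
  let S := ∑ i ∈ Finset.range ℓ, J i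
  let t' := ∏ i ∈ Finset.range ℓ, t i
  have ht' : T ℓ N t' := T.prod _ _ fun i _ => ht i
  have hWS : W = q ^ S * t' := by
    rw [hWprod, Finset.prod_congr rfl fun i _ => hJ i, Finset.prod_mul_distrib,
      Finset.prod_pow_eq_pow_sum]
  have hqS : T ℓ N (W ^ S) := by
    have h1 : ∀ i ∈ Finset.range ℓ, ((g ^ i) q) ^ S = W * (g ^ i) (t'⁻¹) := by
      intro i _
      rw [← map_pow]
      nth_rw 1 [← hgW i]
      rw [← map_mul, hWS]
      congr 1
      have : t' ≠ 0 := by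
        intro h; apply hW0; rw [hWS, h, mul_zero]
      field_simp
    have h2 : W ^ S = W ^ ℓ * ∏ i ∈ Finset.range ℓ, (g ^ i) (t'⁻¹) := by
      nth_rw 1 [hWprod]
      rw [← Finset.prod_pow, Finset.prod_congr rfl h1, Finset.prod_mul_distrib, Finset.prod_const,
        Finset.card_range]
    rw [h2]
    refine T.mul ⟨W, fun τ hτ => ?_, rfl⟩ (T.prod _ _ fun i _ => ht'.inv.map hnorm _)
    rw [hW, map_sub, hgk, ← hzu, map_pow τ, hzN τ hτ]
  have hWN : ∀ τ ∈ N, τ W = W := by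
    intro τ hτ
    rw [hW, map_sub, hgk, ← hzu, map_pow τ, hzN τ hτ]
  by_cases hdiv : ℓ ∣ S
  · obtain ⟨s, hs⟩ := hdiv
    apply hWT
    rw [hWS, hs]
    refine T.mul ⟨q ^ s, fun τ hτ => by rw [map_pow, hqN τ hτ], ?_⟩ ht'
    rw [← pow_mul, mul_comm]
  · have hcop : IsCoprime (S : ℤ) (ℓ : ℤ) :=
      Nat.isCoprime_iff_coprime.2 ((Nat.Prime.coprime_iff_not_dvd hp).2 hdiv).symm
    obtain ⟨s, r, hsr⟩ := hcop
    apply hWT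
    have h1 : W = (W ^ S) ^ s * (W ^ ℓ) ^ r := by
      rw [← zpow_natCast, ← zpow_natCast, ← zpow_mul, ← zpow_mul, ← zpow_add₀ hW0, mul_comm _ s,
        mul_comm _ r, hsr, zpow_one]
    rw [h1]
    exact (hqS.zpow s).mul (T.zpow ⟨W, hWN, rfl⟩ r)

end
end St4

namespace St4
section
variable {ℓ : ℕ} {K Ω : Type*} [Field K] [Field Ω] [Algebra K Ω]

lemma fix_mono (σ : Ω ≃ₐ[K] Ω) {y : Ω} {n m : ℕ} (hnm : n ≤ m) (h : (σ ^ ℓ ^ n) y = y) :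
    (σ ^ ℓ ^ m) y = y := by
  obtain ⟨d, rfl⟩ := Nat.exists_eq_add_of_le hnm
  rw [pow_add, pow_mul]
  have : ∀ i : ℕ, ((σ ^ ℓ ^ n) ^ i) y = y := by
    intro i
    induction i with
    | zero => simp
    | succ i ih => rw [pow_succ, AlgEquiv.mul_apply, h, ih]
  exact this _

/-- Elements with finite `ℓ`-power orbit. -/
def fixF (ℓ : ℕ) (σ : Ω ≃ₐ[K] Ω) : IntermediateField K Ω where
  carrier := {y | ∃ n : ℕ, (σ ^ ℓ ^ n) y = y}
  mul_mem' := by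
    rintro a b ⟨n, hn⟩ ⟨m, hm⟩
    refine ⟨max n m, ?_⟩
    rw [map_mul, fix_mono σ (le_max_left n m) hn, fix_mono σ (le_max_right n m) hm]
  add_mem' := by
    rintro a b ⟨n, hn⟩ ⟨m, hm⟩
    refine ⟨max n m, ?_⟩
    rw [map_add, fix_mono σ (le_max_left n m) hn, fix_mono σ (le_max_right n m) hm]
  algebraMap_mem' := fun c => ⟨0, by simp⟩
  inv_mem' := by
    rintro a ⟨n, hn⟩
    exact ⟨n, by rw [map_inv₀, hn]⟩

lemma mem_fixF {σ : Ω ≃ₐ[K] Ω} {y : Ω} : y ∈ fixF ℓ σ ↔ ∃ n : ℕ, (σ ^ ℓ ^ n) y = y := Iff.rfl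

lemma proL_le_fixF {K : Type*} [Field K] (ℓ : ℕ) [Fact ℓ.Prime]
    (σ : AlgebraicClosure K ≃ₐ[K] AlgebraicClosure K) :
    proL ℓ K ≤ fixF ℓ σ := by
  refine iSup₂_le ?_
  rintro E ⟨hE, n, hn⟩ y hy
  refine ⟨n, ?_⟩
  have hfin : FiniteDimensional K E := FiniteDimensional.of_finrank_pos (by
    rw [hn]; exact pow_pos (Fact.out : ℓ.Prime).pos _)
  have h1 : (AlgEquiv.restrictNormalHom E σ) ^ ℓ ^ n = 1 := by
    rw [← hn, ← IsGalois.card_aut_eq_finrank K E]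
    exact pow_card_eq_one'
  rw [← map_pow] at h1
  have h2 := AlgEquiv.restrictNormalHom_apply E (σ ^ ℓ ^ n) ⟨y, hy⟩
  rw [h1] at h2
  exact h2.symm

lemma exists_gal [Fact ℓ.Prime] [IsAlgClosed Ω] [Algebra.IsAlgebraic K Ω] (y : Ω)
    (hs : IsSeparable K y) (h : ∀ σ : Ω ≃ₐ[K] Ω, y ∈ fixF ℓ σ) :
    ∃ E : IntermediateField K Ω, (IsGalois K E ∧ ∃ n : ℕ, Module.finrank K E = ℓ ^ n) ∧ y ∈ E := by
  have : IsAlgClosure K Ω := ⟨inferInstance, inferInstance⟩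
  have : Normal K Ω := IsAlgClosure.normal K Ω
  obtain ⟨f, hf⟩ : ∃ f, f = minpoly K y := ⟨_, rfl⟩
  have hint : IsIntegral K y := hs.isIntegral
  have hf0 : f ≠ 0 := hf ▸ minpoly.ne_zero hint
  let E : IntermediateField K Ω := IntermediateField.adjoin K (f.rootSet Ω)
  have hsplit : f.IsSplittingField K E :=
    IntermediateField.adjoin_rootSet_isSplittingField (IsAlgClosed.splits _)
  have hgal : IsGalois K E := IsGalois.of_separable_splitting_field (p := f) (by rw [hf]; exact hs)
  have hfin : FiniteDimensional K E := Polynomial.IsSplittingField.finiteDimensional E f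
  have hEfix : ∀ σ : Ω ≃ₐ[K] Ω, E ≤ fixF ℓ σ := by
    intro σ
    refine IntermediateField.adjoin_le_iff.2 ?_
    intro x hx
    have hconj : IsConjRoot K y x := by
      rw [isConjRoot_iff_aeval_eq_zero hint]
      rw [← hf]; exact (Polynomial.mem_rootSet.1 hx).2
    obtain ⟨ρ, hρ⟩ := isConjRoot_iff_exists_algEquiv.1 hconj.symm
    obtain ⟨n, hn⟩ := h (ρ⁻¹ * σ * ρ)
    refine ⟨n, ?_⟩
    have e : (ρ⁻¹ * σ * ρ) ^ ℓ ^ n = ρ⁻¹ * σ ^ ℓ ^ n * ρ := by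
      have := conj_pow (a := ρ⁻¹) (b := σ) (i := ℓ ^ n)
      rwa [inv_inv] at this
    rw [e, AlgEquiv.mul_apply, AlgEquiv.mul_apply, hρ] at hn
    have := congrArg ρ hn
    rw [← AlgEquiv.mul_apply ρ, mul_inv_cancel, hρ] at this
    exact this
  have hyE : y ∈ E := IntermediateField.subset_adjoin _ _
    (Polynomial.mem_rootSet.2 ⟨hf0, by rw [hf]; exact minpoly.aeval K y⟩)
  have hpg : IsPGroup ℓ (E ≃ₐ[K] E) := by
    intro τ
    obtain ⟨σ, hσ⟩ := AlgEquiv.restrictNormalHom_surjective (F := K) (K₁ := E) Ω τ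
    obtain ⟨α, hα⟩ := Field.exists_primitive_element K E
    obtain ⟨n, hn⟩ := hEfix σ α.2
    refine ⟨n, ?_⟩
    have h1 : (τ ^ ℓ ^ n) α = α := by
      apply Subtype.ext
      rw [← hσ, ← map_pow, AlgEquiv.restrictNormalHom_apply, hn]
    have h2 : (⊤ : IntermediateField K E) ≤ fixF 1 (τ ^ ℓ ^ n) := by
      rw [← hα, IntermediateField.adjoin_simple_le_iff]
      exact ⟨0, by simpa using h1⟩
    refine AlgEquiv.ext fun x => ?_
    obtain ⟨m, hm⟩ := h2 (x := x) trivial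
    simpa using hm
  obtain ⟨n, hn⟩ := IsPGroup.iff_card.1 hpg
  rw [IsGalois.card_aut_eq_finrank] at hn
  exact ⟨E, ⟨hgal, n, hn⟩, hyE⟩

lemma mem_proL {K : Type*} [Field K] (ℓ : ℕ) [Fact ℓ.Prime] (y : AlgebraicClosure K)
    (hs : IsSeparable K y)
    (h : ∀ σ : AlgebraicClosure K ≃ₐ[K] AlgebraicClosure K, y ∈ fixF ℓ σ) : y ∈ proL ℓ K := by
  obtain ⟨E, hE, hy⟩ := exists_gal y hs h
  have hle : E ≤ proL ℓ K :=
    le_iSup₂_of_le (f := fun (L : IntermediateField K (AlgebraicClosure K)) _ => L) E hE le_rfl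
  exact hle hy

instance proL_galois {K : Type*} [Field K] (ℓ : ℕ) : IsGalois K (proL ℓ K) := by
  unfold proL
  rw [iSup_subtype']
  have h1 : ∀ i : {L : IntermediateField K (AlgebraicClosure K) //
      L ∈ {L : IntermediateField K (AlgebraicClosure K) |
      IsGalois K L ∧ ∃ n : ℕ, Module.finrank K L = ℓ ^ n}}, Normal K i.1 :=
    fun i => i.2.1.to_normal
  have h2 : ∀ i : {L : IntermediateField K (AlgebraicClosure K) //
      L ∈ {L : IntermediateField K (AlgebraicClosure K) |
      IsGalois K L ∧ ∃ n : ℕ, Module.finrank K L = ℓ ^ n}}, Algebra.IsSeparable K i.1 :=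
    fun i => i.2.1.to_isSeparable
  exact ⟨⟩

lemma proL_root {K : Type*} [Field K] (ℓ : ℕ) [Fact ℓ.Prime] (hℓ : (ℓ : K) ≠ 0)
    (ζ : K) (hζ : IsPrimitiveRoot ζ ℓ) (y : proL ℓ K) : ∃ r, r ^ ℓ = y := by
  have hp : ℓ.Prime := Fact.out
  by_cases hy0 : y = 0
  · exact ⟨0, by rw [hy0, zero_pow hp.ne_zero]⟩
  obtain ⟨r, hr⟩ := IsAlgClosed.exists_pow_nat_eq (y : AlgebraicClosure K) hp.pos
  have hy0' : (y : AlgebraicClosure K) ≠ 0 := fun h => hy0 (Subtype.ext h)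
  have hr0 : r ≠ 0 := by
    rintro rfl
    rw [zero_pow hp.ne_zero] at hr
    exact hy0' hr.symm
  have hs : IsSeparable (proL ℓ K) r := by
    have hsep : (Polynomial.X ^ ℓ - Polynomial.C y).Separable :=
      Polynomial.separable_X_pow_sub_C y (by
        intro h
        apply hℓ
        apply (algebraMap K (proL ℓ K)).injective
        rw [map_natCast, map_zero, h]) hy0
    refine hsep.of_dvd (minpoly.dvd _ _ ?_)
    rw [map_sub, map_pow, Polynomial.aeval_X, Polynomial.aeval_C, hr]
    exact sub_self _
  have hs' : IsSeparable K r := IsSeparable.of_algebra_isSeparable_of_isSeparable K hs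
  have hmem : r ∈ proL ℓ K := by
    refine mem_proL ℓ r hs' fun σ => ?_
    obtain ⟨n, hn⟩ := proL_le_fixF ℓ σ y.2
    refine ⟨n + 1, ?_⟩
    have h1 : ((σ ^ ℓ ^ n) r / r) ^ ℓ = 1 := by
      rw [div_pow, ← map_pow, hr, hn, div_self hy0']
    obtain ⟨c, hc⟩ := root_mem ζ hζ _ h1
    have h2 := pow_apply_root (σ ^ ℓ ^ n) r c (by rw [hc, div_mul_cancel₀ _ hr0]) ℓ
    rw [hc, h1, one_mul] at h2
    rwa [pow_succ, pow_mul]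
  exact ⟨⟨r, hmem⟩, Subtype.ext hr⟩

lemma proL_pow {K : Type*} [Field K] (ℓ : ℕ) [Fact ℓ.Prime]
    (τ : proL ℓ K ≃ₐ[K] proL ℓ K) (y : proL ℓ K) : ∃ n : ℕ, (τ ^ ℓ ^ n) y = y := by
  obtain ⟨σ, hσ⟩ := AlgEquiv.restrictNormalHom_surjective (F := K) (K₁ := proL ℓ K)
    (AlgebraicClosure K) τ
  obtain ⟨n, hn⟩ := proL_le_fixF ℓ σ y.2
  refine ⟨n, Subtype.ext ?_⟩
  rw [← hσ, ← map_pow, AlgEquiv.restrictNormalHom_apply, hn]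

end
end St4

/-- For a function field `K'|k` of transcendence degree `≥ 1` over an
algebraic closure `k` of a finite field of characteristic `p ≠ ℓ`, every closed abelian
normal subgroup of `G^ℓ_{K'}` is trivial. -/
theorem statement4 (ℓ p : ℕ) [Fact ℓ.Prime] [Fact p.Prime] (hpℓ : p ≠ ℓ)
    (k K' : Type*) [Field k] [Field K'] [Algebra k K']
    [IsAlgClosed k] [CharP k p] (hkfin : Algebra.IsAlgebraic (⊥ : Subfield k) k)
    (hKfg : (⊤ : IntermediateField k K').FG) (htd : 1 ≤ trdeg k K')
    (N : Subgroup (GalL ℓ K')) (hclosed : IsClosed (N : Set (GalL ℓ K')))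
    (hnorm : N.Normal) (hab : ∀ a ∈ N, ∀ b ∈ N, a * b = b * a) :
    N = ⊥ := by
  have hp : ℓ.Prime := Fact.out
  have hℓ : (ℓ : k) ≠ 0 := by
    intro h
    rw [CharP.cast_eq_zero_iff k p] at h
    exact hpℓ ((Nat.prime_dvd_prime_iff_eq Fact.out hp).1 h)
  have hℓK : (ℓ : K') ≠ 0 := by
    intro h
    apply hℓ
    apply (algebraMap k K').injective
    rw [map_natCast, map_zero, h]
  have : NeZero ℓ := ⟨hp.ne_zero⟩
  have : NeZero (ℓ : k) := ⟨hℓ⟩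
  obtain ⟨ζ, hζ⟩ := HasEnoughRootsOfUnity.exists_primitiveRoot k ℓ
  have hζK := hζ.map_of_injective (algebraMap k K').injective
  have : Algebra.EssFiniteType k K' := IntermediateField.fg_top_iff.1 hKfg
  letI : Algebra k (proL ℓ K') :=
    ((algebraMap K' (proL ℓ K')).comp (algebraMap k K')).toAlgebra
  have : IsScalarTower k K' (proL ℓ K') := IsScalarTower.of_algebraMap_eq fun _ => rfl
  exact St4.core (k := k) hℓ (St4.proL_root ℓ hℓK _ hζK) (St4.proL_pow ℓ) N hnorm hab
end

section
/- Let ℓ ≠ p be primes, k an algebraic closure of a finite field of characteristic p, and K|k a function field with td(K|k) > 1. Then the map v ↦ Z_v, sending a Zariski prime divisor v of K^ℓ (given by its valuation ring, i.e., a valuation subring of K^ℓ whose restriction to K is the valuation ring of a Zariski prime divisor of K|k) to its decomposition group Z_v in G^ℓ_K, is a bijection from the set of Zariski prime divisors of K^ℓ onto the set of divisorial subgroups of G^ℓ_K. -/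
open IntermediateField

section Valuations

variable {F E : Type*} [Field F] [Field E] [Algebra F E]

private theorem aut_apply_inv_apply (a : E ≃ₐ[F] E) (x : E) : a (a⁻¹ x) = x :=
  a.apply_symm_apply x

/-- The decomposition subgroup of a valuation of `E` in the Galois group of `E|F`:
the stabilizer of the valuation ring. -/
def decompSubgroup (O : ValuationSubring E) : Subgroup (E ≃ₐ[F] E) where
  carrier := {σ | ∀ x : E, σ x ∈ O ↔ x ∈ O}
  one_mem' := by intro x; rfl
  mul_mem' := by
    intro a b ha hb x
    simpa [AlgEquiv.mul_apply] using (ha (b x)).trans (hb x)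
  inv_mem' := by
    intro a ha x
    have h := (ha (a⁻¹ x)).symm
    rwa [aut_apply_inv_apply] at h

/-- The inertia subgroup of a valuation of `E` in the Galois group of `E|F`: the elements of
the decomposition group which act trivially on the residue field. -/
def inertiaSubgroup (O : ValuationSubring E) : Subgroup (E ≃ₐ[F] E) where
  carrier := {σ | (∀ x : E, σ x ∈ O ↔ x ∈ O) ∧
      ∀ x : E, x ∈ O → O.valuation (σ x - x) < 1}
  one_mem' := by
    refine ⟨fun x => Iff.rfl, fun x _ => ?_⟩
    simp
  mul_mem' := by
    rintro a b ⟨had, hai⟩ ⟨hbd, hbi⟩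
    refine ⟨fun x => by simpa [AlgEquiv.mul_apply] using (had (b x)).trans (hbd x), ?_⟩
    intro x hx
    have h1 : O.valuation (a (b x) - b x) < 1 := hai (b x) ((hbd x).mpr hx)
    have h2 : O.valuation (b x - x) < 1 := hbi x hx
    have h3 : (a * b) x - x = (a (b x) - b x) + (b x - x) := by
      rw [AlgEquiv.mul_apply]; ring
    rw [h3]
    exact lt_of_le_of_lt (O.valuation.map_add _ _) (max_lt h1 h2)
  inv_mem' := by
    rintro a ⟨had, hai⟩
    have hdec : ∀ x : E, a⁻¹ x ∈ O ↔ x ∈ O := by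
      intro x
      have h := (had (a⁻¹ x)).symm
      rwa [aut_apply_inv_apply] at h
    refine ⟨hdec, ?_⟩
    intro x hx
    have h1 : O.valuation (a (a⁻¹ x) - a⁻¹ x) < 1 := hai _ ((hdec x).mpr hx)
    rw [aut_apply_inv_apply] at h1
    have h3 : a⁻¹ x - x = -(x - a⁻¹ x) := by ring
    rw [h3, Valuation.map_neg]
    exact h1

end Valuations

section ZPD

variable {k K : Type*} [Field k] [Field K] [Algebra k K]

/-- The canonical map from the base field to the residue field of a valuation subring whose
ring contains the base field. -/
noncomputable def resMap (O : ValuationSubring K)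
    (h : ∀ c : k, algebraMap k K c ∈ O) : k →+* IsLocalRing.ResidueField ↥O :=
  (IsLocalRing.residue ↥O).comp ((algebraMap k K).codRestrict O.toSubring h)

/-- A Zariski prime divisor of `K|k`, given by its valuation ring `O`: a nontrivial valuation
of `K`, trivial on `k`, with value group isomorphic to `ℤ`, whose residue field `Kv` satisfies
`td(Kv|k) = td(K|k) - 1`. -/
structure IsZPD (k : Type*) [Field k] {K : Type*} [Field K] [Algebra k K]
    (O : ValuationSubring K) : Prop where
  trivialBase : ∀ c : k, algebraMap k K c ∈ O
  nontrivial : O ≠ ⊤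
  discrete : Nonempty ((O.ValueGroup)ˣ ≃* Multiplicative ℤ)
  residue_td :
    letI := (resMap O trivialBase).toAlgebra
    trdeg k (IsLocalRing.ResidueField ↥O) + 1 = trdeg k K

end ZPD

/-- A divisorial subgroup of `G^ℓ_K`: the decomposition group of a prolongation to `K^ℓ` of a
Zariski prime divisor of `K|k`. -/
noncomputable def IsDivisorialSubgroup (ℓ : ℕ) (k : Type*) (K : Type*) [Field k] [Field K]
    [Algebra k K] (Z : Subgroup (GalL ℓ K)) : Prop :=
  ∃ O' : ValuationSubring ↥(proL ℓ K),
    IsZPD k (O'.comap (algebraMap K ↥(proL ℓ K))) ∧ Z = decompSubgroup O'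

section Aux

open Polynomial

theorem int_of_val {R E : Type*} [CommRing R] [Field E] [Algebra R E] (z : E)
    (h : ∀ V : ValuationSubring E, (∀ r : R, algebraMap R E r ∈ V) → z ∈ V) : IsIntegral R z := by
  let S : Subring E := (integralClosure R E).toSubring
  have : IsIntegrallyClosedIn S E := by
    rw [Subring.isIntegrallyClosedIn_iff]
    intro x hx
    have : IsIntegral (integralClosure R E) x := hx
    exact isIntegral_trans x this
  by_contra hz
  obtain ⟨V, hV, hzV⟩ := Subring.exists_le_valuationSubring_of_isIntegrallyClosedIn (R := S) (x := z) hz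
  exact hzV (h V fun r => hV (show _ ∈ integralClosure R E from algebraMap_mem _ r))

theorem exists_frac {N E : Type*} [Field N] [Field E] [Algebra N E] [Algebra.IsAlgebraic N E]
    (O : ValuationSubring E) (z : E) (hz : z ∈ O) :
    ∃ b c : E, b * z = c ∧ IsIntegral (O.comap (algebraMap N E)) b ∧
      IsIntegral (O.comap (algebraMap N E)) c ∧ O.valuation b = 1 := by
  classical
  by_cases hz0 : z = 0
  · exact ⟨1, 0, by simp [hz0], isIntegral_one, isIntegral_zero, by simp⟩
  set w := O.valuation with hw
  obtain ⟨p, hp0, hp⟩ := Algebra.IsAlgebraic.isAlgebraic (R := N) z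
  let f : ℕ → _ := fun i => w (algebraMap N E (p.coeff i))
  -- max value
  obtain ⟨j, hj, hjmax⟩ := Finset.exists_max_image p.support f (by simpa using hp0)
  have hj' : ∀ i, f i ≤ f j := by
    intro i
    by_cases hi : i ∈ p.support
    · exact hjmax i hi
    · have : f i = 0 := by simp [f, Polynomial.notMem_support_iff.1 hi]
      rw [this]; exact zero_le
  obtain ⟨k, hk, hkmax⟩ := Finset.exists_max_image (p.support.filter (fun i => f i = f j)) id
    ⟨j, by simp only [Finset.mem_filter, hj, and_self]⟩
  simp only [Finset.mem_filter] at hk hkmax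
  have hkc : p.coeff k ≠ 0 := by simpa using hk.1
  have hkc' : algebraMap N E (p.coeff k) ≠ 0 := by simpa using hkc
  have hwk : w (algebraMap N E (p.coeff k)) ≠ 0 := by simpa using hkc
  let a : ℕ → E := fun i => algebraMap N E (p.coeff i / p.coeff k)
  have ha : ∀ i, w (a i) = f i / f k := by intro i; simp [a, f]
  have hale : ∀ i, w (a i) ≤ 1 := by
    intro i
    rw [ha, hk.2, ← hk.2]
    exact div_le_one_of_le₀ (hk.2 ▸ hj' i) zero_le
  have hak : a k = 1 := by simp [a, hkc]
  have halt : ∀ i, k < i → w (a i) < 1 := by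
    intro i hi
    refine lt_of_le_of_ne (hale i) fun h => ?_
    rw [ha, div_eq_one_iff_eq hwk] at h
    have hne : f i ≠ 0 := by rw [h]; exact hwk
    have : i ∈ p.support := by
      rw [Polynomial.mem_support_iff]; intro h0; apply hne; simp [f, h0]
    have := hkmax i ⟨this, h.trans hk.2⟩
    simp at this; omega
  set n := p.natDegree + 1 with hn
  have hkn : k < n := by have := Polynomial.le_natDegree_of_ne_zero hkc; omega
  have hsum : ∑ i ∈ Finset.range n, a i * z ^ i = 0 := by
    rw [Polynomial.aeval_eq_sum_range] at hp
    have : ∑ i ∈ Finset.range n, a i * z ^ i = (algebraMap N E (p.coeff k))⁻¹ *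
        ∑ i ∈ Finset.range n, p.coeff i • z ^ i := by
      rw [Finset.mul_sum]
      refine Finset.sum_congr rfl fun i _ => ?_
      simp only [a, map_div₀, Algebra.smul_def]; field_simp
    rw [this, hp, mul_zero]
  let b : E := ∑ i ∈ Finset.range (n - k), a (k + i) * z ^ i
  have hsplit : b * z ^ k = - ∑ i ∈ Finset.range k, a i * z ^ i := by
    have h1 : n = k + (n - k) := by omega
    rw [h1, Finset.sum_range_add] at hsum
    rw [eq_neg_iff_add_eq_zero, ← hsum, add_comm]
    congr 1
    rw [Finset.sum_mul]
    refine Finset.sum_congr rfl fun i _ => ?_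
    ring
  have hwz : w z ≤ 1 := (O.valuation_le_one_iff z).2 hz
  have hb1 : w b = 1 := by
    have : b = 1 + ∑ i ∈ Finset.range (n - k - 1), a (k + (i + 1)) * z ^ (i + 1) := by
      have h2 : n - k = (n - k - 1) + 1 := by omega
      simp only [b]
      rw [h2, Finset.sum_range_succ']
      simp [hak]; ring
    rw [this]
    apply Valuation.map_one_add_of_lt
    apply Valuation.map_sum_lt _ one_ne_zero
    intro i _
    rw [map_mul, map_pow]
    exact mul_lt_one_of_lt_of_le (halt _ (by omega)) (pow_le_one₀ zero_le hwz)
  have hmem : ∀ V : ValuationSubring E, (∀ r : O.comap (algebraMap N E),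
      algebraMap (O.comap (algebraMap N E)) E r ∈ V) → b ∈ V ∧ b * z ∈ V := by
    intro V hV
    have haV : ∀ i, a i ∈ V := by
      intro i
      exact hV ⟨p.coeff i / p.coeff k, by
        rw [ValuationSubring.mem_comap, ← ValuationSubring.valuation_le_one_iff]; exact hale i⟩
    rcases V.mem_or_inv_mem z with h | h
    · have : b ∈ V := sum_mem fun i _ => mul_mem (haV _) (pow_mem h i)
      exact ⟨this, mul_mem this h⟩
    · have hc : b * z ∈ V := by
        have hk0 : k ≠ 0 := by
          intro h0
          subst h0
          simp at hsplit
          simp [hsplit] at hb1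
        obtain ⟨m, rfl⟩ := Nat.exists_eq_succ_of_ne_zero hk0
        have : b * z = - ∑ i ∈ Finset.range (m+1), a i * (z⁻¹) ^ (m - i) := by
          have h3 : b * z = (b * z ^ (m+1)) * (z⁻¹) ^ m := by
            rw [pow_succ, inv_pow]; field_simp
          rw [h3, hsplit, neg_mul, Finset.sum_mul]
          congr 1
          refine Finset.sum_congr rfl fun i hi => ?_
          have him : i ≤ m := by simp at hi; omega
          rw [mul_assoc, inv_pow, inv_pow, pow_sub₀ _ hz0 him]
          field_simp
        rw [this]
        exact neg_mem (sum_mem fun i _ => mul_mem (haV _) (pow_mem h _))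
      refine ⟨?_, hc⟩
      have : b = b * z * z⁻¹ := by field_simp
      rw [this]; exact mul_mem hc h
  exact ⟨b, b * z, rfl, int_of_val _ fun V hV => (hmem V hV).1,
    int_of_val _ fun V hV => (hmem V hV).2, hb1⟩


open scoped Pointwise in
theorem trans_val {N E : Type*} [Field N] [Field E] [Algebra N E] [IsGalois N E]
    (O O' : ValuationSubring E) (h : O.comap (algebraMap N E) = O'.comap (algebraMap N E)) :
    ∃ g : E ≃ₐ[N] E, ∀ x, g x ∈ O' ↔ x ∈ O := by
  set R := O.comap (algebraMap N E) with hR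
  let B := integralClosure R E
  let : TopologicalSpace B := ⊥
  have : DiscreteTopology B := ⟨rfl⟩
  have hsc : SMulCommClass (E ≃ₐ[N] E) R E := ⟨fun g r x => by
    have : ∀ x : E, r • x = (r : N) • x := fun x => rfl
    rw [this, this, smul_comm]⟩
  have hcont : ContinuousSMul (E ≃ₐ[N] E) B := by
    rw [continuousSMul_iff_stabilizer_isOpen]
    intro b
    have := stabilizer_isOpen_of_isIntegral (K := N) (b : E)
    convert this using 2
    ext g
    simp only [MulAction.mem_stabilizer_iff]
    exact Subtype.ext_iff
  have hinv : Algebra.IsInvariant R B (E ≃ₐ[N] E) := by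
    refine ⟨fun b hb => ?_⟩
    have h1 : ∀ g : E ≃ₐ[N] E, g (b : E) = b := fun g => congrArg Subtype.val (hb g)
    obtain ⟨a, ha⟩ := (InfiniteGalois.mem_range_algebraMap_iff_fixed (b : E)).2 h1
    have hb2 : IsIntegral R (b : E) := b.2
    rw [← ha, isIntegral_algebraMap_iff (FaithfulSMul.algebraMap_injective N E)] at hb2
    obtain ⟨r, hr⟩ := IsIntegrallyClosed.algebraMap_eq_of_integral hb2
    refine ⟨r, Subtype.ext ?_⟩
    rw [← ha, ← hr]; rfl
  have hle : ∀ V : ValuationSubring E, V.comap (algebraMap N E) = R → ∀ b : B, (b : E) ∈ V := by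
    intro V hV b
    have hb : IsIntegral R (b : E) := b.2
    obtain ⟨p, hp, hpb⟩ := hb
    have : IsIntegral V (b : E) := by
      have hm : ∀ r : R, algebraMap R E r ∈ V.toSubring := fun r => by
        have h0 : (r : N) ∈ V.comap (algebraMap N E) := hV.symm ▸ r.2
        exact h0
      let φ : R →+* V := (algebraMap R E).codRestrict V.toSubring hm
      refine ⟨p.map φ, hp.map _, ?_⟩
      rw [Polynomial.eval₂_map]; exact hpb
    obtain ⟨r, hr⟩ := IsIntegrallyClosed.algebraMap_eq_of_integral this
    rw [← hr]; exact r.2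
  let ι (V : ValuationSubring E) (hV : V.comap (algebraMap N E) = R) : B →+* V :=
    (algebraMap B E).codRestrict V.toSubring (hle V hV)
  let P (V : ValuationSubring E) (hV : V.comap (algebraMap N E) = R) : Ideal B :=
    (IsLocalRing.maximalIdeal V).comap (ι V hV)
  have hPmem : ∀ V hV b, b ∈ P V hV ↔ V.valuation (b : E) < 1 := by
    intro V hV b
    exact (ValuationSubring.valuation_lt_one_iff V (ι V hV b)).symm.symm
  have hunder : (P O hR.symm).under R = (P O' h.symm).under R := by
    ext r
    refine (hPmem O hR.symm _).trans (Iff.trans ?_ (hPmem O' h.symm _).symm)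
    have key : ∀ r : N, ∀ V : ValuationSubring E, V.comap (algebraMap N E) = R →
      (V.valuation (algebraMap N E r) < 1 ↔ r = 0 ∨ r⁻¹ ∉ R) := by
      intro r V hV
      by_cases h0 : r = 0
      · simp [h0]
      · rw [← hV, ValuationSubring.mem_comap, ← ValuationSubring.valuation_le_one_iff, map_inv₀, map_inv₀,
          inv_le_one₀ (by simpa [zero_lt_iff] using h0)]
        simp [h0]
    exact (key r O hR.symm).trans (key r O' h.symm).symm
  have : ∀ V hV, (P V hV).IsPrime := fun V hV => Ideal.comap_isPrime _ _
  obtain ⟨g, hg⟩ := Algebra.IsInvariant.exists_smul_of_under_eq_of_profinite (G := E ≃ₐ[N] E)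
    (P O hR.symm) (P O' h.symm) hunder
  have fin : ∀ (V : ValuationSubring E) (hV : V.comap (algebraMap N E) = R)
      (V' : ValuationSubring E) (hV' : V'.comap (algebraMap N E) = R) (g : E ≃ₐ[N] E),
      P V' hV' = g • P V hV → ∀ x ∈ V, g x ∈ V' := by
    intro V hV V' hV' g hg x hx
    obtain ⟨b, c, hbc, hb, hc, hb1⟩ := exists_frac (N := N) V x hx
    rw [hV] at hb hc
    let b' : B := ⟨b, hb⟩
    let c' : B := ⟨c, hc⟩
    have h1 : b' ∉ P V hV := by rw [hPmem V hV]; simp [b', hb1]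
    have h2 : g • b' ∉ P V' hV' := by rw [hg, Ideal.smul_mem_pointwise_smul_iff]; exact h1
    rw [hPmem V' hV', not_lt] at h2
    have h3 : V'.valuation (g c) ≤ 1 := (V'.valuation_le_one_iff _).2 (hle V' hV' (g • c'))
    have h4 : V'.valuation (g b) ≤ 1 := (V'.valuation_le_one_iff _).2 (hle V' hV' (g • b'))
    have h5 : V'.valuation (g b) = 1 := le_antisymm h4 h2
    rw [← V'.valuation_le_one_iff]
    rw [← hbc, map_mul, map_mul, h5, one_mul] at h3
    exact h3
  refine ⟨g, fun x => ⟨fun hx => ?_, fin O hR.symm O' h.symm g hg x⟩⟩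
  have := fin O' h.symm O hR.symm g⁻¹ (by rw [hg, inv_smul_smul]) _ hx
  rwa [show g⁻¹ (g x) = x from g.symm_apply_apply x] at this

theorem sum_val {E Γ ι : Type*} [Field E] [LinearOrderedCommGroupWithZero Γ] (w : Valuation E Γ)
    (s : Finset ι) (f : ι → E) (h0 : ∀ i ∈ s, f i ≠ 0)
    (hinj : ∀ i ∈ s, ∀ j ∈ s, w (f i) = w (f j) → i = j) (hs : s.Nonempty) :
    ∃ j ∈ s, w (∑ i ∈ s, f i) = w (f j) ∧ ∀ i ∈ s, w (f i) ≤ w (f j) := by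
  classical
  obtain ⟨j, hj, hmax⟩ := Finset.exists_max_image s (fun i => w (f i)) hs
  refine ⟨j, hj, ?_, hmax⟩
  rw [← Finset.add_sum_erase s f hj]
  apply Valuation.map_add_eq_of_lt_left
  apply Valuation.map_sum_lt _ (by simpa using h0 j hj)
  intro i hi
  rw [Finset.mem_erase] at hi
  exact lt_of_le_of_ne (hmax i hi.2) fun h => hi.1 (hinj i hi.2 j hj h)

theorem sum_val_congr {E Γ ι : Type*} [Field E] [LinearOrderedCommGroupWithZero Γ]
    (w : Valuation E Γ)
    (s : Finset ι) (f g : ι → E) (h0 : ∀ i ∈ s, f i ≠ 0)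
    (hinj : ∀ i ∈ s, ∀ j ∈ s, w (f i) = w (f j) → i = j) (hfg : ∀ i, w (f i) = w (g i)) :
    w (∑ i ∈ s, f i) = w (∑ i ∈ s, g i) := by
  rcases s.eq_empty_or_nonempty with rfl | hs
  · simp
  obtain ⟨j, hj, h1, h2⟩ := sum_val w s f h0 hinj hs
  obtain ⟨j', hj', h1', h2'⟩ := sum_val w s g (fun i hi => by
    rw [← w.ne_zero_iff, ← hfg, w.ne_zero_iff]; exact h0 i hi)
    (fun i hi j hj h => hinj i hi j hj (by rwa [hfg, hfg])) hs
  rw [h1, h1']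
  apply le_antisymm
  · rw [hfg j]; exact h2' j hj
  · rw [← hfg j']; exact h2 j' hj'

theorem torsion_val {K E Γ : Type*} [Field K] [Field E] [Algebra K E] [FiniteDimensional K E]
    [LinearOrderedCommGroupWithZero Γ] (w : Valuation E Γ) (z : E) (hz : z ≠ 0) :
    ∃ n, 0 < n ∧ n ≤ Module.finrank K E ∧ ∃ a : K, a ≠ 0 ∧ w z ^ n = w (algebraMap K E a) := by
  by_contra! H
  have hint : IsIntegral K z := Algebra.IsIntegral.isIntegral z
  set p := minpoly K z with hp
  have hdeg : p.natDegree ≤ Module.finrank K E := minpoly.natDegree_le z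
  have hp0 : p ≠ 0 := minpoly.ne_zero hint
  have hw : w z ≠ 0 := by simpa using hz
  have aux : ∀ i ∈ p.support, ∀ j ∈ p.support,
      w (algebraMap K E (p.coeff i) * z ^ i) = w (algebraMap K E (p.coeff j) * z ^ j) → ¬ i < j := by
    intro i hi j hj h hij
    rw [Polynomial.mem_support_iff] at hi hj
    refine H (j - i) (by omega) ?_ (p.coeff i / p.coeff j) (div_ne_zero hi hj) ?_
    · have := Polynomial.le_natDegree_of_ne_zero hj; omega
    · have hj' : w (algebraMap K E (p.coeff j)) ≠ 0 := by simpa using hj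
      rw [pow_sub₀ _ hw hij.le, map_div₀, map_div₀]
      simp only [map_mul, map_pow] at h
      field_simp
      rw [mul_comm, ← h, mul_comm]
  obtain ⟨j, hj, h1, -⟩ := sum_val w p.support (fun i => algebraMap K E (p.coeff i) * z ^ i)
    (by intro i hi; rw [Polynomial.mem_support_iff] at hi; simp [hi, hz])
    (by
      intro i hi j hj h
      rcases lt_trichotomy i j with h' | h' | h'
      · exact absurd h' (aux i hi j hj h)
      · exact h'
      · exact absurd h' (aux j hj i hi h.symm))
    (by simpa using hp0)
  have h2 : ∑ i ∈ p.support, algebraMap K E (p.coeff i) * z ^ i = 0 := by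
    have := minpoly.aeval K z
    rw [Polynomial.aeval_eq_sum_range, ← hp] at this
    rw [← this]
    simp only [← Algebra.smul_def]
    apply Finset.sum_subset
    · exact Polynomial.supp_subset_range_natDegree_succ
    · intro i _ hi
      rw [Polynomial.notMem_support_iff.1 hi, zero_smul]
  rw [h2, map_zero] at h1
  rw [Polynomial.mem_support_iff] at hj
  have := (w.ne_zero_iff (x := algebraMap K E (p.coeff j) * z ^ j)).2 (by simp [hj, hz])
  exact this h1.symm

/-- almost discrete -/
def Disc {M Γ : Type*} [Field M] [LinearOrderedCommGroupWithZero Γ] (w : Valuation M Γ) : Prop :=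
  ∃ π : M, π ≠ 0 ∧ w π < 1 ∧ ∃ D : ℕ, 0 < D ∧ ∀ z : M, z ≠ 0 → ∃ m : ℤ, w z ^ D = w π ^ m

theorem Disc.arch {M Γ : Type*} [Field M] [LinearOrderedCommGroupWithZero Γ] {w : Valuation M Γ}
    (h : Disc w) (c t : M) (hc : w c < 1) : ∃ n0 : ℕ, ∀ n ≥ n0, w (t * c ^ n) < 1 := by
  obtain ⟨π, hπ0, hπ, D, hD, H⟩ := h
  have hw0 : 0 < w π := by simpa [zero_lt_iff] using hπ0
  rcases eq_or_ne c 0 with rfl | hc0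
  · exact ⟨1, fun n hn => by simp [zero_pow (show n ≠ 0 by omega)]⟩
  rcases eq_or_ne t 0 with rfl | ht0
  · exact ⟨0, by simp⟩
  obtain ⟨m, hm⟩ := H c hc0
  obtain ⟨r, hr⟩ := H t ht0
  have hm0 : 0 < m := by
    have : w c ^ D < 1 := pow_lt_one₀ zero_le hc hD.ne'
    rw [hm] at this
    by_contra hneg
    exact absurd this (not_lt.2 (one_le_zpow_of_nonpos₀ hw0 hπ.le (not_lt.1 hneg)))
  refine ⟨r.natAbs + 1, fun n hn => ?_⟩
  have h1 : w (t * c ^ n) ^ D = w π ^ (r + m * n) := by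
    rw [map_mul, map_pow, mul_pow, ← pow_mul, mul_comm n D, pow_mul, hm, hr, zpow_add₀ hw0.ne',
      zpow_mul, zpow_natCast]
  have h2 : 0 < r + m * n := by
    have : (n : ℤ) ≤ m * n := by nlinarith
    omega
  by_contra hneg
  have h3 := one_le_pow₀ (n := D) (not_lt.1 hneg)
  rw [h1] at h3
  exact absurd h3 (not_le.2 (zpow_lt_one₀ hw0 hπ h2))

theorem Disc.nondiv {M Γ : Type*} [Field M] [LinearOrderedCommGroupWithZero Γ] {w : Valuation M Γ}
    (h : Disc w) (l : ℕ) (hl : 1 < l) : ∃ t : M, t ≠ 0 ∧ ∀ z : M, w t ≠ w z ^ l := by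
  obtain ⟨π, hπ0, hπ, D, hD, H⟩ := h
  have hw0 : 0 < w π := by simpa [zero_lt_iff] using hπ0
  by_contra! hcon
  have key : ∀ n : ℕ, ∃ z : M, z ≠ 0 ∧ w π = w z ^ (l ^ n) := by
    intro n
    induction n with
    | zero => exact ⟨π, hπ0, by simp⟩
    | succ n ih =>
      obtain ⟨z, hz, h1⟩ := ih
      obtain ⟨y, hy⟩ := hcon z hz
      refine ⟨y, ?_, ?_⟩
      · rintro rfl
        rw [map_zero, zero_pow (by omega)] at hy
        exact hz (by simpa using hy)
      · rw [h1, hy, ← pow_mul, pow_succ']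
  obtain ⟨z, hz, h1⟩ := key D
  obtain ⟨m, hm⟩ := H z hz
  have h2 : w π ^ (D : ℤ) = w π ^ (m * (l ^ D : ℕ)) := by
    rw [zpow_mul, ← hm, zpow_natCast, zpow_natCast]
    conv_lhs => rw [h1]
    rw [← pow_mul, ← pow_mul, mul_comm]
  have h3 := zpow_right_injective₀ hw0 hπ.ne h2
  have h4 : D < l ^ D := Nat.lt_pow_self hl
  have h5 : (D : ℤ) < (l ^ D : ℕ) := by exact_mod_cast h4
  have h6 : 0 < m := by
    by_contra hneg
    have : m * (l ^ D : ℕ) ≤ 0 := mul_nonpos_of_nonpos_of_nonneg (not_lt.1 hneg) (by positivity)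
    omega
  nlinarith

theorem choose_aux {M Γ Γ' : Type*} [Field M] [LinearOrderedCommGroupWithZero Γ]
    [LinearOrderedCommGroupWithZero Γ'] {w : Valuation M Γ} {w' : Valuation M Γ'}
    (h : Disc w) (h' : Disc w') (a : M) (ha : w a ≤ 1) (ha' : 1 < w' a) :
    ∃ c : M, w c < 1 ∧ 1 < w' c := by
  obtain ⟨π, hπ0, hπ, -⟩ := id h
  have hinv : w' a⁻¹ < 1 := by rw [map_inv₀]; exact inv_lt_one_of_one_lt₀ ha'
  obtain ⟨n, hn⟩ := h'.arch a⁻¹ π⁻¹ hinv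
  refine ⟨π * a ^ n, ?_, ?_⟩
  · rw [map_mul, map_pow]
    exact mul_lt_one_of_lt_of_le hπ (pow_le_one₀ zero_le ha)
  · have := hn n le_rfl
    have e : π⁻¹ * a⁻¹ ^ n = (π * a ^ n)⁻¹ := by rw [mul_inv, inv_pow]
    rw [e, map_inv₀] at this
    have hne : π * a ^ n ≠ 0 := by
      have : a ≠ 0 := by rintro rfl; simp at ha'
      positivity
    exact (inv_lt_one₀ (by simpa [zero_lt_iff] using hne)).1 this

theorem choose_x {M Γ Γ' : Type*} [Field M] [LinearOrderedCommGroupWithZero Γ]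
    [LinearOrderedCommGroupWithZero Γ'] {w : Valuation M Γ} {w' : Valuation M Γ'}
    (h : Disc w) (h' : Disc w') (l : ℕ) (hl : 1 < l) (a : M)
    (ha : ¬ (w a ≤ 1 ↔ w' a ≤ 1)) :
    ∃ x : M, w (x - 1) < 1 ∧ ∀ z : M, w' x ≠ w' z ^ l := by
  have hc : ∃ c : M, w c < 1 ∧ 1 < w' c := by
    by_cases h1 : w a ≤ 1
    · have h2 : 1 < w' a := by
        by_contra h2; exact ha (by simp [h1, not_lt.1 h2])
      exact choose_aux h h' a h1 h2
    · have h2 : w' a ≤ 1 := by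
        by_contra h2; exact ha (by simp [h1, h2])
      obtain ⟨c, hc, hc'⟩ := choose_aux h' h a h2 (not_le.1 h1)
      refine ⟨c⁻¹, ?_, ?_⟩
      · rw [map_inv₀]; exact inv_lt_one_of_one_lt₀ hc'
      · have : c ≠ 0 := by rintro rfl; simp at hc'
        rw [map_inv₀]; exact (one_lt_inv₀ (by simpa [zero_lt_iff] using this)).2 hc
  obtain ⟨c, hc, hc'⟩ := hc
  have hc0 : c ≠ 0 := by rintro rfl; simp at hc'
  obtain ⟨t, ht0, ht⟩ := h'.nondiv l hl
  obtain ⟨n, hn⟩ := h.arch c t hc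
  obtain ⟨n', hn'⟩ := h'.arch c⁻¹ t⁻¹ (by rw [map_inv₀]; exact inv_lt_one_of_one_lt₀ hc')
  set N := l * (n + n') with hN
  have hNn : n + n' ≤ N := Nat.le_mul_of_pos_left _ (by omega)
  refine ⟨1 + t * c ^ N, ?_, ?_⟩
  · rw [add_sub_cancel_left]; exact hn _ (by omega)
  · have h1 : 1 < w' (t * c ^ N) := by
      have := hn' N (by omega)
      have e : t⁻¹ * c⁻¹ ^ N = (t * c ^ N)⁻¹ := by rw [mul_inv, inv_pow]
      rw [e, map_inv₀] at this
      exact (inv_lt_one₀ (by simp [zero_lt_iff, ht0, hc0])).1 this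
    intro z hz
    rw [Valuation.map_add_eq_of_lt_right w' (by simpa using h1)] at hz
    apply ht (z / c ^ (n + n'))
    rw [map_div₀, div_pow, ← hz, map_mul, map_pow, map_pow, ← pow_mul, mul_comm (n+n') l, ← hN,
      mul_div_assoc, div_self, mul_one]
    exact pow_ne_zero _ (by simpa using hc0)

theorem unit_root {M E : Type*} [Field M] [Field E] [Algebra M E]
    (O : ValuationSubring E) {l : ℕ} (hl : 0 < l) (x : M) (y : E) (hy : y ^ l = algebraMap M E x)
    (hy1 : O.valuation (y - 1) < 1)
    (hroots : ∀ ζ : E, ζ ^ l = 1 → O.valuation (ζ - 1) < 1 → ζ = 1)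
    (σ : E ≃ₐ[M] E) (hσ : ∀ z, σ z ∈ O ↔ z ∈ O) : σ y = y := by
  have hval : ∀ z, O.valuation z < 1 → O.valuation (σ z) < 1 := by
    intro z hz
    by_contra h
    by_cases h0 : z = 0
    · subst h0; simp at h
    have h0' : σ z ≠ 0 := by simpa using h0
    have : O.valuation (σ z)⁻¹ ≤ 1 := by rw [map_inv₀]; exact inv_le_one_of_one_le₀ (not_lt.1 h)
    rw [O.valuation_le_one_iff, ← map_inv₀, hσ, ← O.valuation_le_one_iff, map_inv₀,
      inv_le_one₀ (by simpa [zero_lt_iff] using h0)] at this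
    exact absurd hz (not_lt.2 this)
  have h1 : O.valuation (σ y - 1) < 1 := by simpa using hval _ hy1
  have hy1' : O.valuation y = 1 := by
    have := O.valuation.map_one_add_of_lt hy1
    simpa using this
  have hy0 : y ≠ 0 := by rintro rfl; simp at hy1'
  have h2 : σ y / y = 1 := by
    apply hroots
    · rw [div_pow, ← map_pow, hy, AlgEquiv.commutes, div_self]
      rw [← hy]; exact pow_ne_zero _ hy0
    · have : σ y / y - 1 = ((σ y - 1) - (y - 1)) / y := by field_simp; ring
      rw [this, map_div₀, hy1', div_one]
      exact lt_of_le_of_lt (O.valuation.map_sub _ _) (max_lt h1 hy1)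
  field_simp at h2
  exact h2

theorem ram_root {M E : Type*} [Field M] [Field E] [Algebra M E] [IsGalois M E]
    (O : ValuationSubring E) {l : ℕ} (hl : l.Prime) (x : M) (y : E) (hy : y ^ l = algebraMap M E x)
    (hx : ∀ z : M, O.valuation (algebraMap M E x) ≠ O.valuation (algebraMap M E z) ^ l) :
    ∃ σ : E ≃ₐ[M] E, (∀ z, σ z ∈ O ↔ z ∈ O) ∧ σ y ≠ y := by
  set w := O.valuation with hw
  have hy0 : y ≠ 0 := by
    rintro rfl
    rw [zero_pow hl.ne_zero] at hy
    apply hx 0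
    rw [← hy]; simp [hl.ne_zero]
  have hwy : w y ≠ 0 := by simpa using hy0
  have hx0 : algebraMap M E x ≠ 0 := by rw [← hy]; exact pow_ne_zero _ hy0
  -- values of y
  have hdist : ∀ (d : ℕ) (b : M), 0 < d → d < l → w y ^ d ≠ w (algebraMap M E b) := by
    intro d b hd hdl h
    have hcop : Nat.Coprime d l := (Nat.coprime_of_lt_prime hd.ne' hdl hl).symm
    have hbez := Nat.gcd_eq_gcd_ab d l
    rw [hcop.gcd_eq_one] at hbez
    apply hx (b ^ (d.gcdA l) * x ^ (d.gcdB l))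
    rw [← hy, map_pow]
    congr 1
    rw [map_mul, map_zpow₀, map_zpow₀, map_mul, map_zpow₀, map_zpow₀, ← h, ← hy, map_pow,
      ← zpow_natCast, ← zpow_mul, ← zpow_natCast, ← zpow_mul, ← zpow_add₀ hwy, ← hbez]
    simp
  obtain ⟨τ, hτ⟩ : ∃ τ : E ≃ₐ[M] E, τ y ≠ y := by
    by_contra! h
    obtain ⟨a, ha⟩ := (InfiniteGalois.mem_range_algebraMap_iff_fixed y).2 h
    exact hx a (by rw [← hy, ← ha, map_pow])
  have hτw : w (τ y) = w y := by
    have h1 : w (τ y) ^ l = w y ^ l := by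
      rw [← map_pow, ← map_pow, ← map_pow, hy, AlgEquiv.commutes]
    exact (pow_left_inj₀ zero_le zero_le hl.ne_zero).1 h1
  -- uniqueness on N
  let N := IntermediateField.adjoin M {y}
  have huniq : ∀ u ∈ N, w (τ u) = w u := by
    intro u hu
    have halg : IsAlgebraic M y := Algebra.IsAlgebraic.isAlgebraic y
    have hu' : u ∈ N.toSubalgebra := hu
    rw [IntermediateField.adjoin_simple_toSubalgebra_of_isAlgebraic halg,
      Algebra.adjoin_singleton_eq_range_aeval] at hu'
    obtain ⟨q, hq⟩ := hu'
    have hmon : (Polynomial.X ^ l - Polynomial.C x : Polynomial M).Monic :=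
      Polynomial.monic_X_pow_sub_C x hl.ne_zero
    set r := q %ₘ (Polynomial.X ^ l - Polynomial.C x) with hr
    have hru : Polynomial.aeval y r = u := by
      rw [← hq, hr]
      conv_rhs => rw [← Polynomial.modByMonic_add_div q (Polynomial.X ^ l - Polynomial.C x)]
      simp [hy]
    have hrdeg : r.natDegree < l := by
      have := Polynomial.natDegree_modByMonic_lt q hmon (by
        intro h
        have := congrArg Polynomial.natDegree h
        rw [Polynomial.natDegree_X_pow_sub_C] at this
        simp at this
        exact hl.ne_zero this)
      rwa [Polynomial.natDegree_X_pow_sub_C] at this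
    have hsum : ∀ y' : E, Polynomial.aeval y' r =
        ∑ i ∈ r.support, algebraMap M E (r.coeff i) * y' ^ i := by
      intro y'
      rw [Polynomial.aeval_eq_sum_range]
      simp only [← Algebra.smul_def]
      symm
      apply Finset.sum_subset
      · exact Polynomial.supp_subset_range_natDegree_succ
      · intro i _ hi
        rw [Polynomial.notMem_support_iff.1 hi, zero_smul]
    have hτu : τ u = Polynomial.aeval (τ y) r := by
      rw [← hru, Polynomial.aeval_algEquiv]; rfl
    rw [hτu, ← hru, hsum, hsum]
    symm
    have aux : ∀ i ∈ r.support, ∀ j ∈ r.support,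
      w (algebraMap M E (r.coeff i) * y ^ i) = w (algebraMap M E (r.coeff j) * y ^ j) →
        ¬ i < j := by
      intro i hi j hj h hij
      rw [Polynomial.mem_support_iff] at hi hj
      have := Polynomial.le_natDegree_of_ne_zero hj
      refine hdist (j - i) (r.coeff i / r.coeff j) (by omega) (by omega) ?_
      have hj' : w (algebraMap M E (r.coeff j)) ≠ 0 := by simpa using hj
      rw [pow_sub₀ _ hwy hij.le, map_div₀, map_div₀]
      simp only [map_mul, map_pow] at h
      field_simp
      rw [mul_comm, ← h, mul_comm]
    apply sum_val_congr
    · intro i hi; rw [Polynomial.mem_support_iff] at hi; simp [hi, hy0]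
    · intro i hi j hj h
      rcases lt_trichotomy i j with h' | h' | h'
      · exact absurd h' (aux i hi j hj h)
      · exact h'
      · exact absurd h' (aux j hj i hi h.symm)
    · intro i
      simp [hτw]
  -- O' = τ⁻¹ O
  let O' : ValuationSubring E := O.comap (τ : E →+* E)
  have hcomap : O'.comap (algebraMap N E) = O.comap (algebraMap N E) := by
    ext u
    rw [ValuationSubring.mem_comap, ValuationSubring.mem_comap, ValuationSubring.mem_comap,
      ← O.valuation_le_one_iff, ← O.valuation_le_one_iff]
    exact (congrArg (· ≤ 1) (huniq _ u.2)).to_iff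
  obtain ⟨g, hg⟩ := trans_val (N := N) O O' hcomap.symm
  refine ⟨τ * (g.restrictScalars M), fun z => ?_, ?_⟩
  · exact hg z
  · have : g y = y := g.commutes ⟨y, IntermediateField.mem_adjoin_simple_self M y⟩
    change τ (g y) ≠ y
    rwa [this]

/-- elements fixed by an ℓ-power of σ -/
def fixL {K A : Type*} [Field K] [Field A] [Algebra K A] (ℓ : ℕ) (σ : A ≃ₐ[K] A) :
    IntermediateField K A where
  carrier := {x | ∃ n : ℕ, ∀ m ≥ n, (σ ^ (ℓ ^ m)) x = x}
  mul_mem' := by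
    rintro a b ⟨n, hn⟩ ⟨m, hm⟩
    exact ⟨n + m, fun q hq => by rw [map_mul, hn q (by omega), hm q (by omega)]⟩
  one_mem' := ⟨0, by simp⟩
  add_mem' := by
    rintro a b ⟨n, hn⟩ ⟨m, hm⟩
    exact ⟨n + m, fun q hq => by rw [map_add, hn q (by omega), hm q (by omega)]⟩
  zero_mem' := ⟨0, by simp⟩
  algebraMap_mem' := fun r => ⟨0, by simp⟩
  inv_mem' := by
    rintro a ⟨n, hn⟩
    exact ⟨n, fun q hq => by rw [map_inv₀, hn q hq]⟩

theorem pow_fix {K A : Type*} [Field K] [Field A] [Algebra K A] (σ : A ≃ₐ[K] A) (x : A)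
    (h : σ x = x) (n : ℕ) : (σ ^ n) x = x := by
  induction n with
  | zero => simp
  | succ n ih => rw [pow_succ, AlgEquiv.mul_apply, h, ih]

theorem mem_fixL_of {K A : Type*} [Field K] [Field A] [Algebra K A] {ℓ : ℕ} {σ : A ≃ₐ[K] A}
    {x : A} (n : ℕ) (h : (σ ^ (ℓ ^ n)) x = x) : x ∈ fixL ℓ σ := by
  refine ⟨n, fun m hm => ?_⟩
  obtain ⟨d, rfl⟩ := Nat.exists_eq_add_of_le hm
  rw [pow_add, pow_mul]
  exact pow_fix _ _ h _

theorem proL_le_fixL (ℓ : ℕ) [Fact ℓ.Prime] (K : Type*) [Field K]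
    (σ : AlgebraicClosure K ≃ₐ[K] AlgebraicClosure K) : proL ℓ K ≤ fixL ℓ σ := by
  refine iSup₂_le fun L hL => ?_
  obtain ⟨hG, n, hn⟩ := hL
  have hfd : FiniteDimensional K L := FiniteDimensional.of_finrank_pos (by
    rw [hn]; exact pow_pos (Fact.out : ℓ.Prime).pos _)
  intro x hx
  apply mem_fixL_of n
  have h1 : (AlgEquiv.restrictNormalHom L σ) ^ (ℓ ^ n) = 1 := by
    rw [← hn, ← IsGalois.card_aut_eq_finrank]; exact pow_card_eq_one'
  rw [← map_pow] at h1
  have h2 := AlgEquiv.restrictNormal_commutes (σ ^ (ℓ ^ n)) L ⟨x, hx⟩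
  have h3 : (σ ^ (ℓ ^ n)).restrictNormal L = 1 := h1
  rw [h3] at h2
  exact h2.symm

theorem mem_proL_of (ℓ : ℕ) [Fact ℓ.Prime] (K : Type*) [Field K] (z : AlgebraicClosure K)
    (hsep : IsSeparable K z)
    (h : ∀ σ : AlgebraicClosure K ≃ₐ[K] AlgebraicClosure K, z ∈ fixL ℓ σ) : z ∈ proL ℓ K := by
  let A := AlgebraicClosure K
  have hnA : Normal K A := IsAlgClosure.normal K A
  let p := minpoly K z
  let F : IntermediateField K A := IntermediateField.adjoin K (p.rootSet A)
  have hsf : p.IsSplittingField K F :=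
    IntermediateField.adjoin_rootSet_isSplittingField (IsAlgClosed.splits _)
  have hgal : IsGalois K F := IsGalois.of_separable_splitting_field (p := p) hsep
  have hfd : FiniteDimensional K F := Polynomial.IsSplittingField.finiteDimensional F p
  have hint : IsIntegral K z := Algebra.IsIntegral.isIntegral z
  have hFle : ∀ σ : A ≃ₐ[K] A, F ≤ fixL ℓ σ := by
    intro σ
    rw [IntermediateField.adjoin_le_iff]
    intro y hy
    have hc : IsConjRoot K y z := by
      exact ((isConjRoot_iff_mem_minpoly_rootSet hint).2 hy).symm
    obtain ⟨ρ, hρ⟩ := isConjRoot_iff_exists_algEquiv.1 hc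
    obtain ⟨n, hn⟩ := h (ρ⁻¹ * σ * ρ)
    apply mem_fixL_of n
    have h1 := hn n le_rfl
    have h2 : (ρ⁻¹ * σ * ρ) ^ (ℓ ^ n) = ρ⁻¹ * σ ^ (ℓ ^ n) * ρ := by
      have := conj_pow (a := ρ⁻¹) (b := σ) (i := ℓ ^ n)
      rwa [inv_inv] at this
    rw [h2, AlgEquiv.mul_apply, AlgEquiv.mul_apply, hρ] at h1
    have h3 := congrArg ρ h1
    rw [hρ, show ∀ t, ρ (ρ⁻¹ t) = t from fun t => ρ.apply_symm_apply t] at h3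
    exact h3
  have hP : IsPGroup ℓ (F ≃ₐ[K] F) := by
    intro σ
    let pb := Field.powerBasisOfFiniteOfSeparable K F
    let σ' : A ≃ₐ[K] A := σ.liftNormal A
    obtain ⟨n, hn⟩ := hFle σ' pb.gen.2
    refine ⟨n, ?_⟩
    have hcomm : ∀ m : ℕ, ∀ x : F, (((σ ^ m) x : F) : A) = (σ' ^ m) x := by
      intro m
      induction m with
      | zero => simp
      | succ m ih =>
        intro x
        rw [pow_succ, pow_succ, AlgEquiv.mul_apply, AlgEquiv.mul_apply, ih]
        congr 1
        exact (AlgEquiv.liftNormal_commutes σ A x).symm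
    have h1 : ((σ ^ (ℓ ^ n) : F ≃ₐ[K] F) : F →ₐ[K] F) = AlgHom.id K F := by
      apply pb.algHom_ext
      apply Subtype.ext
      exact (hcomm _ _).trans (hn n le_rfl)
    ext x
    exact congrArg Subtype.val (DFunLike.congr_fun h1 x)
  obtain ⟨n, hn⟩ := IsPGroup.iff_card.1 hP
  have hFp : F ≤ proL ℓ K := le_iSup₂_of_le F
    ⟨hgal, n, by rw [← IsGalois.card_aut_eq_finrank, hn]⟩ le_rfl
  apply hFp
  apply IntermediateField.subset_adjoin
  rw [Polynomial.mem_rootSet]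
  exact ⟨minpoly.ne_zero hint, minpoly.aeval K z⟩

theorem proL_isGalois (ℓ : ℕ) (K : Type*) [Field K] : IsGalois K (proL ℓ K) := by
  have e : proL ℓ K = ⨆ L : {L : IntermediateField K (AlgebraicClosure K) |
      IsGalois K L ∧ ∃ n : ℕ, Module.finrank K L = ℓ ^ n}, L.1 := by
    rw [proL, iSup_subtype']
  have hg : ∀ L : {L : IntermediateField K (AlgebraicClosure K) |
      IsGalois K L ∧ ∃ n : ℕ, Module.finrank K L = ℓ ^ n}, IsGalois K L.1 := fun L => L.2.1
  rw [e]
  have h1 := IntermediateField.normal_iSup K (AlgebraicClosure K) (fun L : {L : IntermediateField K (AlgebraicClosure K) |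
      IsGalois K L ∧ ∃ n : ℕ, Module.finrank K L = ℓ ^ n} => L.1)
  have hs : ∀ L : {L : IntermediateField K (AlgebraicClosure K) |
      IsGalois K L ∧ ∃ n : ℕ, Module.finrank K L = ℓ ^ n}, Algebra.IsSeparable K L.1 :=
    fun L => (hg L).to_isSeparable
  have h2 : Algebra.IsSeparable K ↥(⨆ L : {L : IntermediateField K (AlgebraicClosure K) |
      IsGalois K L ∧ ∃ n : ℕ, Module.finrank K L = ℓ ^ n}, L.1) :=
    IntermediateField.isSeparable_iSup _ _
  exact { to_isSeparable := h2, to_normal := h1 }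

theorem root_mem_proL (ℓ : ℕ) [Fact ℓ.Prime] (K : Type*) [Field K] (hℓ : (ℓ : K) ≠ 0) (ζ : K)
    (hζ : IsPrimitiveRoot ζ ℓ) (x : proL ℓ K) : ∃ y : proL ℓ K, y ^ ℓ = x := by
  have hlp : ℓ.Prime := Fact.out
  obtain ⟨y, hy⟩ := IsAlgClosed.exists_pow_nat_eq (x : AlgebraicClosure K) hlp.pos
  by_cases hx0 : x = 0
  · exact ⟨0, by rw [hx0, zero_pow hlp.ne_zero]⟩
  have hx0' : (x : AlgebraicClosure K) ≠ 0 := by simpa using hx0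
  have hy0 : y ≠ 0 := by rintro rfl; rw [zero_pow hlp.ne_zero] at hy; exact hx0' hy.symm
  have hζA := hζ.map_of_injective (f := algebraMap K (AlgebraicClosure K))
    (FaithfulSMul.algebraMap_injective _ _)
  have hmem : y ∈ proL ℓ K := by
    apply mem_proL_of
    · have := proL_isGalois ℓ K
      have hs : IsSeparable (proL ℓ K) y := by
        have hsep : (Polynomial.X ^ ℓ - Polynomial.C x : Polynomial (proL ℓ K)).Separable := by
          apply Polynomial.separable_X_pow_sub_C _ _ hx0
          intro h0
          apply hℓ
          have : algebraMap K (proL ℓ K) (ℓ : K) = 0 := by simpa using h0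
          exact (map_eq_zero _).1 this
        apply hsep.of_dvd
        apply minpoly.dvd
        simp [hy]
      exact IsSeparable.of_algebra_isSeparable_of_isSeparable K hs
    · intro σ
      obtain ⟨n, hn⟩ := proL_le_fixL ℓ K σ x.2
      have hx1 := hn n le_rfl
      set τ := σ ^ (ℓ ^ n) with hτ
      have h1 : (τ y / y) ^ ℓ = 1 := by
        rw [div_pow, ← map_pow, hy, hx1, div_self hx0']
      have : NeZero ℓ := ⟨hlp.ne_zero⟩
      obtain ⟨i, -, hi⟩ := hζA.eq_pow_of_pow_eq_one h1
      rw [← map_pow] at hi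
      set c := ζ ^ i
      have h2 : τ y = algebraMap K _ c * y := by rw [hi]; field_simp
      have h3 : ∀ m : ℕ, (τ ^ m) y = algebraMap K _ c ^ m * y := by
        intro m
        induction m with
        | zero => simp
        | succ m ih =>
          rw [pow_succ, AlgEquiv.mul_apply, h2, map_mul, AlgEquiv.commutes, ih]; ring
      apply mem_fixL_of (n + 1)
      rw [pow_succ, pow_mul, ← hτ, h3, hi, h1, one_mul]
  exact ⟨⟨y, hmem⟩, Subtype.ext hy⟩

theorem disc_of {k K E : Type*} [Field k] [Field K] [Field E] [Algebra k K] [Algebra K E]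
    (O : ValuationSubring E) (h : IsZPD k (O.comap (algebraMap K E)))
    (M : IntermediateField K E) [FiniteDimensional K M] :
    Disc (O.valuation.comap (algebraMap M E)) := by
  set V := O.comap (algebraMap K E) with hV
  set w := O.valuation.comap (algebraMap M E) with hw
  have hle : ∀ a : K, V.valuation a ≤ 1 ↔ w (algebraMap K M a) ≤ 1 := by
    intro a
    rw [ValuationSubring.valuation_le_one_iff, hV, ValuationSubring.mem_comap, hw,
      Valuation.comap_apply, ValuationSubring.valuation_le_one_iff]
    rfl
  have hle2 : ∀ a b : K, a ≠ 0 → b ≠ 0 → V.valuation a ≤ V.valuation b →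
      w (algebraMap K M a) ≤ w (algebraMap K M b) := by
    intro a b ha hb hab
    have hb1 : 0 < V.valuation b := zero_lt_iff.2 ((Valuation.ne_zero_iff _).2 hb)
    have hb2 : 0 < w (algebraMap K M b) :=
      zero_lt_iff.2 ((Valuation.ne_zero_iff _).2 (by simpa using hb))
    have h1 : V.valuation (a / b) ≤ 1 := by
      rw [map_div₀]; exact (div_le_one₀ hb1).2 hab
    rw [hle, map_div₀, map_div₀] at h1
    exact (div_le_one₀ hb2).1 h1
  have hlt : ∀ a : K, a ≠ 0 → V.valuation a < 1 → w (algebraMap K M a) < 1 := by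
    intro a ha h1
    by_contra h2
    push Not at h2
    have h3 : w (algebraMap K M a⁻¹) ≤ 1 := by
      rw [map_inv₀, map_inv₀]; exact inv_le_one_of_one_le₀ h2
    rw [← hle, map_inv₀] at h3
    have h4 : 0 < V.valuation a := zero_lt_iff.2 ((Valuation.ne_zero_iff _).2 ha)
    exact absurd ((inv_le_one₀ h4).1 h3) (not_le.2 h1)
  obtain ⟨e⟩ := h.discrete
  let g := e.symm (Multiplicative.ofAdd 1)
  have hg : ∀ u : (V.ValueGroup)ˣ, ∃ m : ℤ, u = g ^ m := by
    intro u
    refine ⟨(e u).toAdd, ?_⟩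
    apply e.injective
    rw [map_zpow, MulEquiv.apply_symm_apply, ← ofAdd_zsmul]
    simp
  have hg1 : g ≠ 1 := by
    intro h1
    apply h.nontrivial
    rw [eq_top_iff]
    intro a _
    rw [← ValuationSubring.valuation_le_one_iff]
    by_cases ha : a = 0
    · simp [ha]
    obtain ⟨m, hm⟩ := hg (Units.mk0 (V.valuation a) ((Valuation.ne_zero_iff _).2 ha))
    rw [h1, one_zpow] at hm
    exact (congrArg Units.val hm).le
  obtain ⟨g', hg'1, hg'⟩ : ∃ g' : (V.ValueGroup)ˣ, g' < 1 ∧ ∀ u, ∃ m : ℤ, u = g' ^ m := by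
    rcases lt_or_gt_of_ne hg1 with h1 | h1
    · exact ⟨g, h1, hg⟩
    · refine ⟨g⁻¹, inv_lt_one'.2 h1, fun u => ?_⟩
      obtain ⟨m, hm⟩ := hg u
      exact ⟨-m, by rw [hm]; simp⟩
  obtain ⟨π, hπ⟩ := V.valuation_surjective (g' : V.ValueGroup)
  have hπ0 : π ≠ 0 := by
    rintro rfl
    rw [map_zero] at hπ
    exact g'.ne_zero hπ.symm
  have hval : ∀ a : K, a ≠ 0 → ∃ m : ℤ, w (algebraMap K M a) = w (algebraMap K M π) ^ m := by
    intro a ha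
    obtain ⟨m, hm⟩ := hg' (Units.mk0 (V.valuation a) ((Valuation.ne_zero_iff _).2 ha))
    have h1 : V.valuation a = V.valuation (π ^ m) := by
      rw [map_zpow₀, hπ, ← Units.val_zpow_eq_zpow_val, ← hm, Units.val_mk0]
    have h0 : π ^ m ≠ 0 := zpow_ne_zero _ hπ0
    refine ⟨m, ?_⟩
    rw [← map_zpow₀, ← map_zpow₀]
    exact le_antisymm (hle2 _ _ ha h0 h1.le) (hle2 _ _ h0 ha h1.ge)
  refine ⟨algebraMap K M π, by simpa using hπ0, hlt _ hπ0 ?_, (Module.finrank K M).factorial,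
    Nat.factorial_pos _, ?_⟩
  · rw [hπ]; exact_mod_cast hg'1
  intro z hz
  obtain ⟨n, hn, hn', a, ha, hza⟩ := torsion_val (K := K) w z hz
  obtain ⟨d, hd⟩ := Nat.dvd_factorial hn hn'
  obtain ⟨m, hm⟩ := hval a ha
  refine ⟨m * d, ?_⟩
  rw [hd, pow_mul, hza, hm, zpow_mul, zpow_natCast]

theorem const_val {k K E : Type*} [Field k] [Field K] [Field E] [Algebra k K] [Algebra K E]
    (O : ValuationSubring E) (h : IsZPD k (O.comap (algebraMap K E))) (c : k) (hc : c ≠ 0) :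
    O.valuation (algebraMap K E (algebraMap k K c)) = 1 := by
  have h1 : ∀ c : k, O.valuation (algebraMap K E (algebraMap k K c)) ≤ 1 := fun c =>
    (O.valuation_le_one_iff _).2 (h.trivialBase c)
  apply le_antisymm (h1 c)
  have h2 := h1 c⁻¹
  rw [map_inv₀, map_inv₀, map_inv₀] at h2
  have h0 : 0 < O.valuation (algebraMap K E (algebraMap k K c)) :=
    zero_lt_iff.2 ((Valuation.ne_zero_iff _).2 (by simpa using hc))
  exact (inv_le_one₀ h0).1 h2

theorem inj_main (ℓ p : ℕ) [Fact ℓ.Prime] [Fact p.Prime] (hpℓ : p ≠ ℓ)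
    (k K : Type*) [Field k] [Field K] [Algebra k K] [IsAlgClosed k] [CharP k p]
    (O₁ O₂ : ValuationSubring (proL ℓ K))
    (h₁ : IsZPD k (O₁.comap (algebraMap K (proL ℓ K))))
    (h₂ : IsZPD k (O₂.comap (algebraMap K (proL ℓ K))))
    (h : decompSubgroup (F := K) O₁ = decompSubgroup (F := K) O₂) : O₁ = O₂ := by
  classical
  have hlp : ℓ.Prime := Fact.out
  have hpp : p.Prime := Fact.out
  have : NeZero ℓ := ⟨hlp.ne_zero⟩
  have hℓk : (ℓ : k) ≠ 0 := by
    rw [Ne, CharP.cast_eq_zero_iff k p]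
    intro hd
    exact hpℓ ((Nat.prime_dvd_prime_iff_eq hpp hlp).1 hd)
  have hnz : NeZero (ℓ : k) := ⟨hℓk⟩
  obtain ⟨ζ, hζ⟩ := HasEnoughRootsOfUnity.exists_primitiveRoot k ℓ
  have hζK := hζ.map_of_injective (f := algebraMap k K) (FaithfulSMul.algebraMap_injective _ _)
  have hζE := hζK.map_of_injective (f := algebraMap K (proL ℓ K))
    (FaithfulSMul.algebraMap_injective _ _)
  have hℓK : (ℓ : K) ≠ 0 := by
    intro h0
    apply hℓk
    apply FaithfulSMul.algebraMap_injective k K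
    simpa using h0
  have hrt : ∀ ξ : proL ℓ K, ξ ^ ℓ = 1 → ∃ c : k, c ≠ 0 ∧
      ξ = algebraMap K (proL ℓ K) (algebraMap k K c) := by
    intro ξ hξ
    obtain ⟨i, -, hi⟩ := hζE.eq_pow_of_pow_eq_one hξ
    refine ⟨ζ ^ i, pow_ne_zero _ (hζ.ne_zero hlp.ne_zero), ?_⟩
    rw [← hi, map_pow, map_pow]
  have hroots : ∀ ξ : proL ℓ K, ξ ^ ℓ = 1 → O₁.valuation (ξ - 1) < 1 → ξ = 1 := by
    intro ξ hξ h1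
    obtain ⟨c, hc, rfl⟩ := hrt ξ hξ
    by_contra h2
    have h3 : c - 1 ≠ 0 := by
      intro h4
      apply h2
      rw [sub_eq_zero.1 h4, map_one, map_one]
    have h5 := const_val O₁ h₁ (c - 1) h3
    rw [map_sub, map_sub, map_one, map_one] at h5
    exact h1.ne h5
  by_contra hne
  obtain ⟨a, ha⟩ : ∃ a : proL ℓ K, ¬ (a ∈ O₁ ↔ a ∈ O₂) := by
    by_contra hcon
    push Not at hcon
    exact hne (SetLike.ext hcon)
  have hgal := proL_isGalois ℓ K
  have hint : IsIntegral K a := Algebra.IsIntegral.isIntegral a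
  let M : IntermediateField K (proL ℓ K) := IntermediateField.adjoin K {a}
  have hfd : FiniteDimensional K M := IntermediateField.adjoin.finiteDimensional hint
  have hgalM : IsGalois M (proL ℓ K) := IsGalois.tower_top_intermediateField M
  let a' : M := ⟨a, IntermediateField.mem_adjoin_simple_self K a⟩
  obtain ⟨x, hx1, hx2⟩ := choose_x (disc_of O₁ h₁ M) (disc_of O₂ h₂ M) ℓ hlp.one_lt a' (by
    rw [Valuation.comap_apply, Valuation.comap_apply, ValuationSubring.valuation_le_one_iff,
      ValuationSubring.valuation_le_one_iff]
    exact ha)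
  rw [Valuation.comap_apply, map_sub, map_one] at hx1
  obtain ⟨y₀, hy₀⟩ := root_mem_proL ℓ K hℓK _ hζK (algebraMap M (proL ℓ K) x)
  have hfac : O₁.valuation (∏ ξ ∈ Polynomial.nthRootsFinset ℓ (1 : proL ℓ K), (y₀ - ξ)) < 1 := by
    have h1 := congrArg (Polynomial.eval y₀)
      (Polynomial.X_pow_sub_one_eq_prod hlp.pos hζE)
    rw [Polynomial.eval_prod] at h1
    simp only [Polynomial.eval_sub, Polynomial.eval_pow, Polynomial.eval_X, Polynomial.eval_one,
      Polynomial.eval_C] at h1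
    rw [← h1, hy₀]
    exact hx1
  obtain ⟨ξ, hξ, hξ1⟩ : ∃ ξ : proL ℓ K, ξ ^ ℓ = 1 ∧ O₁.valuation (y₀ - ξ) < 1 := by
    by_contra hcon
    push Not at hcon
    rw [map_prod] at hfac
    refine absurd hfac (not_lt.2 ?_)
    refine Finset.prod_induction _ (fun t => 1 ≤ t) (fun _ _ => one_le_mul) le_rfl ?_
    intro ξ hξ
    exact hcon ξ ((Polynomial.mem_nthRootsFinset hlp.pos _).1 hξ)
  have hξ0 : ξ ≠ 0 := by
    rintro rfl
    rw [zero_pow hlp.ne_zero] at hξ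
    exact zero_ne_one hξ
  have hξv : O₁.valuation ξ = 1 := by
    obtain ⟨c, hc, rfl⟩ := hrt ξ hξ
    exact const_val O₁ h₁ c hc
  have hy : (y₀ / ξ) ^ ℓ = algebraMap M (proL ℓ K) x := by rw [div_pow, hξ, div_one, hy₀]
  have hy1 : O₁.valuation (y₀ / ξ - 1) < 1 := by
    have : y₀ / ξ - 1 = (y₀ - ξ) / ξ := by field_simp
    rw [this, map_div₀, hξv, div_one]
    exact hξ1
  obtain ⟨σ, hσ, hσy⟩ := ram_root O₂ hlp x (y₀ / ξ) hy hx2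
  apply hσy
  apply unit_root O₁ hlp.pos x (y₀ / ξ) hy hy1 hroots σ
  have hm : σ.restrictScalars K ∈ decompSubgroup (F := K) O₂ := hσ
  rw [← h] at hm
  exact hm

end Aux

/-- The map `v ↦ Z_v` is a bijection from the set of Zariski prime divisors of
`K^ℓ` (given by their valuation rings) onto the set of divisorial subgroups of `G^ℓ_K`. -/
theorem statement6 (ℓ p : ℕ) [Fact ℓ.Prime] [Fact p.Prime] (hpℓ : p ≠ ℓ)
    (k K : Type*) [Field k] [Field K] [Algebra k K]
    [IsAlgClosed k] [CharP k p] (hkfin : Algebra.IsAlgebraic (⊥ : Subfield k) k)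
    (hKfg : (⊤ : IntermediateField k K).FG) (htd : 1 < trdeg k K) :
    Set.BijOn (fun O' : ValuationSubring ↥(proL ℓ K) => decompSubgroup (F := K) O')
      {O' : ValuationSubring ↥(proL ℓ K) |
        IsZPD k (O'.comap (algebraMap K ↥(proL ℓ K)))}
      {Z : Subgroup (GalL ℓ K) | IsDivisorialSubgroup ℓ k K Z} := by
  refine ⟨fun O hO => ⟨O, hO, rfl⟩, fun O₁ h₁ O₂ h₂ h => ?_, ?_⟩
  · exact inj_main ℓ p hpℓ k K O₁ O₂ h₁ h₂ h
  · rintro Z ⟨O, hO, rfl⟩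
    exact ⟨O, hO, rfl⟩
end
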